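/- Under the stated conditions on (γ, χ, α_0,…,α_N), the real Coulomb gas integral satisfies the BPZ equation of order r: 𝒟_r C^{(l)} = 0 at every point of the ordered domain {t < t_1 < ⋯ < t_N}. -/

import Mathlib

open scoped BigOperators
open MeasureTheory

/-- The first-order differential operator `L_{-n}` acting on functions of
`(t, t₁, …, t_N) ∈ ℝ × (Fin N → ℝ)`. -/
noncomputable def Lop (N : ℕ) (Δ : Fin N → ℂ) (n : ℕ)
    (F : ℝ × (Fin N → ℝ) → ℂ) (p : ℝ × (Fin N → ℝ)) : ℂ :=
  if n = 1 then fderiv ℝ F p (1, 0)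
  else ∑ l : Fin N,
    (-((((p.2 l : ℂ) - (p.1 : ℂ)) ^ (n - 1))⁻¹) * fderiv ℝ F p (0, Pi.single l 1)
      + Δ l * ((n : ℂ) - 1) * ((((p.2 l : ℂ) - (p.1 : ℂ)) ^ n)⁻¹) * F p)

/-- Compositions of `r` into `k` positive parts, as functions `Fin k → ℕ`. -/
def comps (r k : ℕ) : Finset (Fin k → ℕ) :=
  (Fintype.piFinset fun _ : Fin k => Finset.Icc 1 r).filter fun n => ∑ i, n i = r

/-- The Benoît–Saint-Aubin coefficient
`(χ²)^{r−k} / ∏_{j=1}^{k−1} (Σ_{i=1}^j n_i)(Σ_{i=j+1}^k n_i)`. -/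
noncomputable def BSAcoeff (r k : ℕ) (χ : ℂ) (n : Fin k → ℕ) : ℂ :=
  χ ^ (2 * (r - k)) /
    ∏ j ∈ Finset.range (k - 1),
      ((∑ i ∈ Finset.univ.filter (fun i : Fin k => (i : ℕ) ≤ j), (n i : ℂ)) *
        (∑ i ∈ Finset.univ.filter (fun i : Fin k => j < (i : ℕ)), (n i : ℂ)))

/-- The Benoît–Saint-Aubin operator of order `r`. -/
noncomputable def Dr (N : ℕ) (Δ : Fin N → ℂ) (r : ℕ) (χ : ℂ)
    (F : ℝ × (Fin N → ℝ) → ℂ) (p : ℝ × (Fin N → ℝ)) : ℂ :=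
  ∑ k ∈ Finset.Icc 1 r, ∑ n ∈ comps r k,
    BSAcoeff r k χ n * ((List.ofFn n).foldr (Lop N Δ) F) p

/-- The open simplex `{x : a < x₁ < ⋯ < x_l < b}`. -/
def Simplex (l : ℕ) (a b : ℝ) : Set (Fin l → ℝ) :=
  {x | StrictMono x ∧ ∀ s, a < x s ∧ x s < b}

/-- The integrand of the real Coulomb gas integral:
`∏_{s,i} (x_s − T_i)^{−γα_i/2} · ∏_{s'<s} (x_s − x_{s'})^{−γ²/2}`,
where `T : Fin (N+1) → ℝ` collects `t₀ = t, t₁, …, t_N`. -/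
noncomputable def CGint (l N : ℕ) (γ : ℂ) (α : Fin (N + 1) → ℂ)
    (T : Fin (N + 1) → ℝ) (x : Fin l → ℝ) : ℂ :=
  (∏ s : Fin l, ∏ i : Fin (N + 1), (((x s - T i : ℝ) : ℂ) ^ (-(γ * α i) / 2))) *
    ∏ s : Fin l, ∏ s' ∈ Finset.Iio s, (((x s - x s' : ℝ) : ℂ) ^ (-(γ ^ 2) / 2))

/-- The full coordinate vector `T = (t₀, t₁, …, t_N)` with `t₀ = t`. -/
def Tfull {N : ℕ} (p : ℝ × (Fin N → ℝ)) : Fin (N + 1) → ℝ := Fin.cons p.1 p.2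

/-- The real Coulomb gas integral
`C^{(l)}(t,𝐭) = ∏_{0≤i<j≤N} (t_j − t_i)^{−α_iα_j/2} ·
∫_{t_{N−1}<x₁<⋯<x_l<t_N} ∏_{s,i}(x_s − t_i)^{−γα_i/2} ∏_{s'<s}(x_s − x_{s'})^{−γ²/2} dx`. -/
noncomputable def CoulombC (l N : ℕ) (hN : 2 ≤ N) (γ : ℂ) (α : Fin (N + 1) → ℂ)
    (p : ℝ × (Fin N → ℝ)) : ℂ :=
  (∏ i : Fin (N + 1), ∏ j ∈ Finset.Ioi i,
      (((Tfull p j - Tfull p i : ℝ) : ℂ) ^ (-(α i * α j) / 2))) *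
    ∫ x in Simplex l (p.2 ⟨N - 2, by omega⟩) (p.2 ⟨N - 1, by omega⟩),
      CGint l N γ α (Tfull p) x

/-- The ordered domain `{t < t₁ < ⋯ < t_N}`. -/
def OrdDomain (N : ℕ) : Set (ℝ × (Fin N → ℝ)) :=
  {p | (∀ l, p.1 < p.2 l) ∧ StrictMono p.2}

section EulerOperator

variable {R : Type*} [CommRing R]

/-- The Euler operator `v d/dv` on power series. -/
noncomputable def eulerOp (f : PowerSeries R) : PowerSeries R :=
  PowerSeries.mk fun n => (n : R) * PowerSeries.coeff n f

theorem coeff_eulerOp (f : PowerSeries R) (n : ℕ) :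
    PowerSeries.coeff n (eulerOp f) = n * PowerSeries.coeff n f := by
  simp [eulerOp]

theorem eulerOp_mul (f g : PowerSeries R) :
    eulerOp (f * g) = eulerOp f * g + f * eulerOp g := by
  ext1 n
  simp only [coeff_eulerOp, PowerSeries.coeff_mul, map_add, Finset.mul_sum,
    ← Finset.sum_add_distrib]
  refine Finset.sum_congr rfl fun x hx => ?_
  rw [Finset.HasAntidiagonal.mem_antidiagonal] at hx
  rw [← hx]
  push_cast
  ring

theorem eulerOp_C_mul (a : R) (f : PowerSeries R) :
    eulerOp (PowerSeries.C a * f) = PowerSeries.C a * eulerOp f := by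
  ext1 n
  simp only [coeff_eulerOp, PowerSeries.coeff_C_mul]
  ring

theorem coeff_mul_of_coeff_zero {f : PowerSeries R} (g : PowerSeries R)
    (hf : PowerSeries.coeff 0 f = 0) (m : ℕ) :
    PowerSeries.coeff m (f * g) = ∑ i ∈ Finset.range m,
      PowerSeries.coeff (i + 1) f * PowerSeries.coeff (m - 1 - i) g := by
  rw [PowerSeries.coeff_mul, Finset.Nat.sum_antidiagonal_eq_sum_range_succ
    (fun i j => PowerSeries.coeff i f * PowerSeries.coeff j g), Finset.sum_range_succ', hf]
  simp only [zero_mul, add_zero]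
  refine Finset.sum_congr rfl fun i hi => ?_
  rw [Nat.sub_sub, Nat.add_comm 1 i]

/-- The series `∑ₙ xₙ₊ₖ vⁿ`, without its constant term. -/
noncomputable def shiftSeries (x : ℕ → R) (k : ℕ) : PowerSeries R :=
  PowerSeries.mk fun n => if n = 0 then 0 else x (n + k)

theorem coeff_zero_shiftSeries (x : ℕ → R) (k : ℕ) :
    PowerSeries.coeff 0 (shiftSeries x k) = 0 := by
  simp [shiftSeries]

theorem coeff_succ_shiftSeries (x : ℕ → R) (k n : ℕ) :
    PowerSeries.coeff (n + 1) (shiftSeries x k) = x (n + 1 + k) := by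
  simp [shiftSeries]

/-- A derivation shifting power sums acts on `H = exp (c ∑ xₙ vⁿ / n)` by
`H ↦ c (∑ xₙ₊ₖ vⁿ) H`. -/
theorem derivation_coeff_of_eulerOp_eq [IsDomain R] [CharZero R] [Algebra ℂ R]
    (D : Derivation ℂ R R) (x : ℕ → R) (c : R) (hc : D c = 0) (k : ℕ)
    (hx : ∀ a, D (x a) = a * x (a + k)) (H : PowerSeries R)
    (hH0 : D (PowerSeries.coeff 0 H) = 0)
    (hH : eulerOp H = PowerSeries.C c * (shiftSeries x 0 * H)) (m : ℕ) :
    D (PowerSeries.coeff m H) =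
      PowerSeries.coeff m (PowerSeries.C c * (shiftSeries x k * H)) := by
  induction m using Nat.strong_induction_on with
  | _ m ih =>
    rcases Nat.eq_zero_or_pos m with rfl | hm
    · rw [hH0, PowerSeries.coeff_C_mul, coeff_mul_of_coeff_zero _ (coeff_zero_shiftSeries x k)]
      simp
    have hm0 : (m : R) ≠ 0 := by exact_mod_cast hm.ne'
    apply mul_left_cancel₀ hm0
    have h1 : (m : R) * D (PowerSeries.coeff m H) = D (PowerSeries.coeff m (eulerOp H)) := by
      rw [coeff_eulerOp, Derivation.leibniz, Derivation.map_natCast]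
      simp
    rw [h1, ← coeff_eulerOp, eulerOp_C_mul, eulerOp_mul, hH, PowerSeries.coeff_C_mul,
      PowerSeries.coeff_C_mul, Derivation.leibniz, hc, smul_zero, add_zero, smul_eq_mul,
      coeff_mul_of_coeff_zero _ (coeff_zero_shiftSeries x 0), map_sum, map_add]
    have h2 : shiftSeries x k * (PowerSeries.C c * (shiftSeries x 0 * H)) =
      shiftSeries x 0 * (PowerSeries.C c * (shiftSeries x k * H)) := by ring
    rw [h2, coeff_mul_of_coeff_zero _ (coeff_zero_shiftSeries x 0),
      coeff_mul_of_coeff_zero (f := eulerOp _) _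
        (by rw [coeff_eulerOp]; simp), ← Finset.sum_add_distrib]
    congr 1
    refine Finset.sum_congr rfl fun i hi => ?_
    have hi' := Finset.mem_range.1 hi
    rw [Derivation.leibniz, ih (m - 1 - i) (by omega), coeff_eulerOp, coeff_succ_shiftSeries,
      coeff_succ_shiftSeries, hx, smul_eq_mul, smul_eq_mul, add_zero]
    ring

end EulerOperator

/-- The operator by which `L_{-n}` acts on polynomials in the power sums. -/
noncomputable def fockOp (α₀ Q : ℂ) (n : ℕ) (P : MvPolynomial ℕ ℂ) : MvPolynomial ℕ ℂ :=
  MvPolynomial.mkDerivation ℂ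
      (fun a : ℕ => (a : MvPolynomial ℕ ℂ) * MvPolynomial.X (a + n)) P +
    (MvPolynomial.C ((α₀ + ((n : ℂ) - 1) * Q) / 2) * MvPolynomial.X n -
      MvPolynomial.C (1 / 4) * ∑ a ∈ Finset.range (n - 1),
        MvPolynomial.X (a + 1) * MvPolynomial.X (n - 1 - a)) * P

theorem fockOp_add (α₀ Q : ℂ) (n : ℕ) (P P' : MvPolynomial ℕ ℂ) :
    fockOp α₀ Q n (P + P') = fockOp α₀ Q n P + fockOp α₀ Q n P' := by
  simp only [fockOp, map_add]; ring

theorem fockOp_smul (α₀ Q : ℂ) (n : ℕ) (a : ℂ) (P : MvPolynomial ℕ ℂ) :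
    fockOp α₀ Q n (a • P) = a • fockOp α₀ Q n P := by
  simp only [fockOp, Derivation.map_smul, smul_add, mul_smul_comm]

/-- `fockOp` as a linear map. -/
noncomputable def fockLin (α₀ Q : ℂ) (n : ℕ) : MvPolynomial ℕ ℂ →ₗ[ℂ] MvPolynomial ℕ ℂ where
  toFun := fockOp α₀ Q n
  map_add' := fockOp_add α₀ Q n
  map_smul' := fockOp_smul α₀ Q n

/-- The coefficients of `exp (c ∑ pₙ vⁿ / n)` in the power sums `pₙ`. -/
noncomputable def expSum (c : ℂ) : ℕ → MvPolynomial ℕ ℂ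
  | 0 => 1
  | m + 1 => MvPolynomial.C (c / (m + 1 : ℂ)) *
      ∑ i : Fin (m + 1), MvPolynomial.X ((i : ℕ) + 1) * expSum c (m - i)
  decreasing_by omega

theorem natCast_mul_expSum (c : ℂ) (m : ℕ) :
    (m : MvPolynomial ℕ ℂ) * expSum c m =
      MvPolynomial.C c * ∑ i ∈ Finset.range m, MvPolynomial.X (i + 1) * expSum c (m - 1 - i) := by
  cases m with
  | zero => simp
  | succ m =>
    have hm : (m : ℂ) + 1 ≠ 0 := by exact_mod_cast Nat.succ_ne_zero m
    have h1 : ((m + 1 : ℕ) : MvPolynomial ℕ ℂ) = MvPolynomial.C ((m : ℂ) + 1) := by simp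
    rw [expSum, h1, ← mul_assoc, ← map_mul, mul_div_cancel₀ _ hm, Finset.sum_range]
    rfl

theorem eulerOp_expSum (c : ℂ) : eulerOp (PowerSeries.mk (expSum c)) =
    PowerSeries.C (MvPolynomial.C c) *
      (shiftSeries MvPolynomial.X 0 * PowerSeries.mk (expSum c)) := by
  ext1 m
  rw [PowerSeries.coeff_C_mul, coeff_mul_of_coeff_zero _ (coeff_zero_shiftSeries _ 0),
    coeff_eulerOp, PowerSeries.coeff_mk, natCast_mul_expSum]
  simp only [coeff_succ_shiftSeries, PowerSeries.coeff_mk, add_zero]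

theorem mkDerivation_expSum (c : ℂ) (k m : ℕ) :
    MvPolynomial.mkDerivation ℂ
      (fun a : ℕ => (a : MvPolynomial ℕ ℂ) * MvPolynomial.X (a + k)) (expSum c m) =
      MvPolynomial.C c * ∑ a ∈ Finset.range m,
        MvPolynomial.X (a + 1 + k) * expSum c (m - 1 - a) := by
  have h := derivation_coeff_of_eulerOp_eq (MvPolynomial.mkDerivation ℂ
      (fun a : ℕ => (a : MvPolynomial ℕ ℂ) * MvPolynomial.X (a + k))) MvPolynomial.X
      (MvPolynomial.C c) (MvPolynomial.derivation_C _ _) k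
      (fun a => MvPolynomial.mkDerivation_X _ _ a) (PowerSeries.mk (expSum c))
      (by rw [PowerSeries.coeff_mk, expSum, Derivation.map_one_eq_zero]) (eulerOp_expSum c) m
  rw [PowerSeries.coeff_mk, PowerSeries.coeff_C_mul,
    coeff_mul_of_coeff_zero _ (coeff_zero_shiftSeries _ k)] at h
  simpa only [coeff_succ_shiftSeries, PowerSeries.coeff_mk] using h

theorem sum_range_sum_range_sub {M : Type*} [AddCommMonoid M] (g : ℕ → M) (m : ℕ) :
    ∑ i ∈ Finset.range m, ∑ a ∈ Finset.range (m - 1 - i), g (i + a + 1) =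
      ∑ i ∈ Finset.range m, i • g i := by
  induction m with
  | zero => simp
  | succ m ih =>
    rw [Finset.sum_range_succ, Finset.sum_range_succ _ m, ← ih]
    have h : ∀ i ∈ Finset.range m, ∑ a ∈ Finset.range (m + 1 - 1 - i), g (i + a + 1) =
        ∑ a ∈ Finset.range (m - 1 - i), g (i + a + 1) + g m := by
      intro i hi
      have hi' := Finset.mem_range.1 hi
      rw [show m + 1 - 1 - i = (m - 1 - i) + 1 by omega, Finset.sum_range_succ,
        show i + (m - 1 - i) + 1 = m by omega]
    rw [Finset.sum_congr rfl h, Finset.sum_add_distrib]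
    simp

theorem coeff_mul_expSum {f : PowerSeries (MvPolynomial ℕ ℂ)} (c : ℂ)
    (hf : PowerSeries.coeff 0 f = 0) (m : ℕ) :
    PowerSeries.coeff m (f * PowerSeries.mk (expSum c)) = ∑ i ∈ Finset.range m,
      PowerSeries.coeff (i + 1) f * expSum c (m - 1 - i) := by
  simp [coeff_mul_of_coeff_zero _ hf]

theorem sum_mkDerivation_expSum (c : ℂ) (m : ℕ) : ∑ i ∈ Finset.range m, MvPolynomial.mkDerivation ℂ
    (fun a : ℕ => (a : MvPolynomial ℕ ℂ) * MvPolynomial.X (a + (i + 1)))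
    (expSum c (m - 1 - i)) = PowerSeries.coeff m (PowerSeries.C (MvPolynomial.C c) *
      ((eulerOp (shiftSeries MvPolynomial.X 0) - shiftSeries MvPolynomial.X 0) *
        PowerSeries.mk (expSum c))) := by
  set S := shiftSeries (MvPolynomial.X (R := ℂ)) 0 with hS
  have hS0 : PowerSeries.coeff 0 S = 0 := coeff_zero_shiftSeries _ 0
  have hS1 : ∀ i, PowerSeries.coeff (i + 1) S = MvPolynomial.X (i + 1) :=
    fun i => coeff_succ_shiftSeries _ 0 i
  rw [PowerSeries.coeff_C_mul, coeff_mul_expSum _ (by rw [map_sub, coeff_eulerOp, hS0]; simp)]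
  have := sum_range_sum_range_sub
    (fun i => (MvPolynomial.X (i + 1) : MvPolynomial ℕ ℂ) * expSum c (m - 1 - i)) m
  simp only [mkDerivation_expSum, ← Finset.mul_sum]
  congr 1
  refine Eq.trans ?_ (this.trans ?_)
  · refine Finset.sum_congr rfl fun i hi => Finset.sum_congr rfl fun a ha => ?_
    rw [show a + 1 + (i + 1) = i + a + 1 + 1 by ring,
      show m - 1 - i - 1 - a = m - 1 - (i + a + 1) by omega]
  · refine Finset.sum_congr rfl fun i hi => ?_
    rw [map_sub, coeff_eulerOp, hS1, nsmul_eq_mul]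
    push_cast
    ring

theorem sum_mul_expSum (α₀ Q c : ℂ) (m : ℕ) : ∑ i ∈ Finset.range m,
    (MvPolynomial.C ((α₀ + (((i + 1 : ℕ) : ℂ) - 1) * Q) / 2) * MvPolynomial.X (i + 1) -
    MvPolynomial.C (1 / 4) * ∑ a ∈ Finset.range (i + 1 - 1),
      MvPolynomial.X (a + 1) * MvPolynomial.X (i + 1 - 1 - a)) * expSum c (m - 1 - i) =
    PowerSeries.coeff m
      ((PowerSeries.C (MvPolynomial.C (α₀ / 2)) * shiftSeries MvPolynomial.X 0 +
        PowerSeries.C (MvPolynomial.C (Q / 2)) *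
          (eulerOp (shiftSeries MvPolynomial.X 0) - shiftSeries MvPolynomial.X 0) -
        PowerSeries.C (MvPolynomial.C (1 / 4)) *
          (shiftSeries MvPolynomial.X 0 * shiftSeries MvPolynomial.X 0)) *
        PowerSeries.mk (expSum c)) := by
  set S := shiftSeries (MvPolynomial.X (R := ℂ)) 0 with hS
  have hS0 : PowerSeries.coeff 0 S = 0 := coeff_zero_shiftSeries _ 0
  have hS1 : ∀ i, PowerSeries.coeff (i + 1) S = MvPolynomial.X (i + 1) :=
    fun i => coeff_succ_shiftSeries _ 0 i
  rw [coeff_mul_expSum _ (by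
    rw [map_sub, map_add, PowerSeries.coeff_C_mul, PowerSeries.coeff_C_mul,
      PowerSeries.coeff_C_mul, map_sub, coeff_eulerOp, hS0, coeff_mul_of_coeff_zero _ hS0]
    simp)]
  refine Finset.sum_congr rfl fun i hi => ?_
  have h2 : PowerSeries.coeff (i + 1) (S * S) = ∑ a ∈ Finset.range (i + 1 - 1),
      MvPolynomial.X (a + 1) * MvPolynomial.X (i + 1 - 1 - a) := by
    rw [coeff_mul_of_coeff_zero _ hS0, Finset.sum_range_succ]
    simp only [add_tsub_cancel_right, tsub_self, hS0, mul_zero, add_zero]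
    refine Finset.sum_congr rfl fun a ha => ?_
    have := Finset.mem_range.1 ha
    rw [hS1, show i - a = (i - a - 1) + 1 by omega, hS1]
  rw [map_sub, map_add, PowerSeries.coeff_C_mul, PowerSeries.coeff_C_mul,
    PowerSeries.coeff_C_mul, h2, map_sub, coeff_eulerOp, hS1,
    show (α₀ + (((i + 1 : ℕ) : ℂ) - 1) * Q) / 2 = α₀ / 2 + Q / 2 * i by push_cast; ring]
  simp only [map_add, map_mul, map_natCast]
  push_cast
  ring

theorem bsa_ring_identity {A : Type*} [CommRing A] (K : ℂ →+* A) (S E H : A) (χ r : ℂ)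
    (hχ : χ ≠ 0) :
    K (-1 / (2 * χ)) * ((E - S) * H) + (K (-(r - 1) * χ / 2) * S +
      K ((χ + 1 / χ) / 2) * (E - S) - K (1 / 4) * (S * S)) * H =
    K (χ ^ 2 * r) * (K (-1 / (2 * χ)) * (S * H)) -
      K (χ ^ 2) * (K (-1 / (2 * χ)) * (E * H + S * (K (-1 / (2 * χ)) * (S * H)))) := by
  have e1 : K (-1 / (2 * χ)) + K ((χ + 1 / χ) / 2) = -(K (χ ^ 2) * K (-1 / (2 * χ))) := by
    rw [← map_add, ← map_mul, ← map_neg]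
    congr 1; field_simp; ring
  have e2 : K (-(r - 1) * χ / 2) - K ((χ + 1 / χ) / 2) - K (-1 / (2 * χ)) =
      K (χ ^ 2 * r) * K (-1 / (2 * χ)) := by
    rw [← map_sub, ← map_sub, ← map_mul]
    congr 1; field_simp; ring
  have e3 : K (1 / 4) = K (χ ^ 2) * K (-1 / (2 * χ)) * K (-1 / (2 * χ)) := by
    rw [← map_mul, ← map_mul]
    congr 1; field_simp; norm_num
  linear_combination (E * H) * e1 + (S * H) * e2 - (S * S * H) * e3

theorem smul_expSum_eq (c a b : ℂ) (m : ℕ) : (a * (m * (b - m))) • expSum c m =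
    PowerSeries.coeff m (PowerSeries.C (MvPolynomial.C (a * b)) *
        eulerOp (PowerSeries.mk (expSum c)) -
      PowerSeries.C (MvPolynomial.C a) * eulerOp (eulerOp (PowerSeries.mk (expSum c)))) := by
  rw [map_sub, PowerSeries.coeff_C_mul, PowerSeries.coeff_C_mul, coeff_eulerOp, coeff_eulerOp,
    coeff_eulerOp, PowerSeries.coeff_mk, MvPolynomial.smul_eq_C_mul]
  simp only [map_mul, map_sub, map_natCast]
  ring

/-- The recursion whose truncation at level `r` is the Benoît–Saint-Aubin formula. -/
theorem sum_fockOp_expSum (χ : ℂ) (hχ : χ ≠ 0) (r : ℂ) (m : ℕ) :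
    ∑ i ∈ Finset.range m, fockOp (-(r - 1) * χ) (χ + 1 / χ) (i + 1)
        (expSum (-1 / (2 * χ)) (m - 1 - i)) =
      (χ ^ 2 * (m * (r - m))) • expSum (-1 / (2 * χ)) m := by
  simp only [fockOp, Finset.sum_add_distrib]
  rw [sum_mkDerivation_expSum, sum_mul_expSum (-(r - 1) * χ) (χ + 1 / χ) (-1 / (2 * χ)) m,
    smul_expSum_eq (-1 / (2 * χ)) (χ ^ 2) r m]
  refine (map_add (PowerSeries.coeff m) _ _).symm.trans (congrArg (PowerSeries.coeff m) ?_)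
  rw [eulerOp_expSum, eulerOp_C_mul, eulerOp_mul, eulerOp_expSum]
  have h := bsa_ring_identity (PowerSeries.C.comp (MvPolynomial.C (σ := ℕ)))
    (shiftSeries MvPolynomial.X 0) (eulerOp (shiftSeries MvPolynomial.X 0))
    (PowerSeries.mk (expSum (-1 / (2 * χ)))) χ r hχ
  simp only [RingHom.comp_apply] at h
  exact h

theorem mem_comps {r k : ℕ} {n : Fin k → ℕ} :
    n ∈ comps r k ↔ (∀ i, 1 ≤ n i) ∧ ∑ i, n i = r := by
  simp only [comps, Finset.mem_filter, Fintype.mem_piFinset, Finset.mem_Icc]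
  refine ⟨fun h => ⟨fun i => (h.1 i).1, h.2⟩, fun h => ⟨fun i => ⟨h.1 i, ?_⟩, h.2⟩⟩
  rw [← h.2]
  exact Finset.single_le_sum (fun i _ => Nat.zero_le (n i)) (Finset.mem_univ i)

theorem comps_eq_empty {r k : ℕ} (h : r < k) : comps r k = ∅ := by
  refine Finset.eq_empty_of_forall_notMem fun n hn => ?_
  rw [mem_comps] at hn
  have := Finset.sum_le_sum fun i (_ : i ∈ Finset.univ) => hn.1 i
  simp [hn.2] at this
  omega

theorem sum_comps_succ {M : Type*} [AddCommMonoid M] (m k : ℕ) (F : (Fin (k + 1) → ℕ) → M) :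
    ∑ n ∈ comps m (k + 1), F n =
      ∑ j ∈ Finset.range m, ∑ n ∈ comps (m - 1 - j) k, F (Fin.cons (j + 1) n) := by
  rw [Finset.sum_sigma']
  symm
  refine Finset.sum_bij' (fun x _ => Fin.cons (x.1 + 1) x.2) (fun n _ => ⟨n 0 - 1, Fin.tail n⟩)
    ?_ ?_ ?_ ?_ ?_
  · rintro ⟨j, n⟩ h
    rw [Finset.mem_sigma, Finset.mem_range, mem_comps] at h
    rw [mem_comps]
    refine ⟨fun i => ?_, ?_⟩
    · refine Fin.cases ?_ (fun i => ?_) i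
      · simp
      · simpa using h.2.1 i
    · rw [Fin.sum_univ_succ]
      simp only [Fin.cons_zero, Fin.cons_succ, h.2.2]
      have := h.1
      simp only at this ⊢
      omega
  · intro n h
    rw [mem_comps, Fin.sum_univ_succ] at h
    have h0 := h.1 0
    simp only [Finset.mem_sigma, Finset.mem_range, mem_comps]
    refine ⟨by omega, fun i => h.1 i.succ, ?_⟩
    have : ∑ i, Fin.tail n i = ∑ i : Fin k, n i.succ := rfl
    omega
  · rintro ⟨j, n⟩ h
    simp
  · intro n h
    rw [mem_comps] at h
    have h0 := h.1 0
    simp only [Nat.sub_add_cancel h0, Fin.cons_self_tail]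
  · intro x h
    rfl

/-- The sum of the parts from index `j` on. -/
noncomputable def tailSum {k : ℕ} (n : Fin k → ℕ) (j : ℕ) : ℂ :=
  ∑ i ∈ Finset.univ.filter (fun i : Fin k => j ≤ (i : ℕ)), (n i : ℂ)

theorem tailSum_zero {k : ℕ} (n : Fin k → ℕ) : tailSum n 0 = (∑ i, n i : ℕ) := by
  simp [tailSum]

theorem tailSum_cons_succ {k : ℕ} (a : ℕ) (n : Fin k → ℕ) (j : ℕ) :
    tailSum (Fin.cons a n : Fin (k + 1) → ℕ) (j + 1) = tailSum n j := by
  simp [tailSum, Finset.sum_filter, Fin.sum_univ_succ]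

theorem BSAcoeff_cons {r k : ℕ} (χ : ℂ) (a : ℕ) (n : Fin k → ℕ)
    (h : (Fin.cons a n : Fin (k + 1) → ℕ) ∈ comps r (k + 1)) :
    BSAcoeff r (k + 1) χ (Fin.cons a n) =
      χ ^ (2 * (r - (k + 1))) / ∏ j ∈ Finset.range k, (tailSum n j * (r - tailSum n j)) := by
  rw [BSAcoeff]
  congr 1
  refine Finset.prod_congr rfl fun j hj => ?_
  rw [mem_comps] at h
  have h1 : ∑ i ∈ Finset.univ.filter (fun i : Fin (k + 1) => j < (i : ℕ)),
      (((Fin.cons a n : Fin (k + 1) → ℕ) i : ℕ) : ℂ) = tailSum n j := by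
    rw [← tailSum_cons_succ a]
    rfl
  have h2 := Finset.sum_filter_add_sum_filter_not Finset.univ (fun i : Fin (k + 1) => j < (i : ℕ))
    (fun i => (((Fin.cons a n : Fin (k + 1) → ℕ) i : ℕ) : ℂ))
  simp only [not_lt] at h2
  have hr : (r : ℂ) = ∑ i, (((Fin.cons a n : Fin (k + 1) → ℕ) i : ℕ) : ℂ) := by
    rw [← h.2, Nat.cast_sum]
  rw [h1] at h2
  rw [h1, hr, ← h2]
  ring

section Recursion

variable {V : Type*} [AddCommGroup V] [Module ℂ V]

theorem sum_words_eq (L : ℕ → V →ₗ[ℂ] V) (f : ℕ → V) (χ : ℂ) (r : ℕ)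
    (hf : ∀ m, ∑ i ∈ Finset.range m, L (i + 1) (f (m - 1 - i)) =
      (χ ^ 2 * (m * ((r : ℂ) - m))) • f m) (m : ℕ) (hm : m < r) :
    ∑ k ∈ Finset.range (m + 1), ∑ n ∈ comps m k,
      (χ ^ (2 * (m - k)) / ∏ j ∈ Finset.range k, (tailSum n j * (r - tailSum n j))) •
        (List.ofFn n).foldr (fun n v => L n v) (f 0) = χ ^ (2 * m) • f m := by
  induction m using Nat.strong_induction_on with
  | _ m ih =>
    rcases Nat.eq_zero_or_pos m with rfl | hm0
    · have : comps 0 0 = {Fin.elim0} := by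
        ext n
        simp only [mem_comps, Finset.mem_singleton]
        exact ⟨fun _ => Subsingleton.elim _ _, fun _ => by simp⟩
      simp [this]
    have hmr : ((m : ℂ) * ((r : ℂ) - m)) ≠ 0 := by
      refine mul_ne_zero (by exact_mod_cast hm0.ne') (sub_ne_zero.2 ?_)
      exact_mod_cast hm.ne'
    have hne : comps m 0 = ∅ := by
      refine Finset.eq_empty_of_forall_notMem fun n hn => ?_
      rw [mem_comps] at hn
      simp at hn
      omega
    rw [Finset.sum_range_succ', hne, Finset.sum_empty, add_zero]
    simp only [sum_comps_succ]
    rw [Finset.sum_comm]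
    have key : ∀ i ∈ Finset.range m, (∑ k ∈ Finset.range m, ∑ n ∈ comps (m - 1 - i) k,
        (χ ^ (2 * (m - (k + 1))) / ∏ j ∈ Finset.range (k + 1),
          (tailSum (Fin.cons (i + 1) n : Fin (k + 1) → ℕ) j *
            (r - tailSum (Fin.cons (i + 1) n : Fin (k + 1) → ℕ) j))) •
        (List.ofFn (Fin.cons (i + 1) n : Fin (k + 1) → ℕ)).foldr (fun n v => L n v) (f 0)) =
        (χ ^ (2 * (m - 1)) / (m * ((r : ℂ) - m))) • L (i + 1) (f (m - 1 - i)) := by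
      intro i hi
      have hi' := Finset.mem_range.1 hi
      have h1 := congrArg (fun v => ((χ ^ (2 * i)) / (m * ((r : ℂ) - m))) • L (i + 1) v)
        (ih (m - 1 - i) (by omega) (by omega))
      simp only [map_smul, smul_smul] at h1
      rw [show χ ^ (2 * i) / (m * ((r : ℂ) - m)) * χ ^ (2 * (m - 1 - i)) =
        χ ^ (2 * (m - 1)) / (m * ((r : ℂ) - m)) by
          rw [div_mul_eq_mul_div, ← pow_add]; congr 2; omega] at h1
      rw [← h1, show m - 1 - i + 1 = m - i by omega, map_sum, Finset.smul_sum]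
      have hsub : Finset.range (m - i) ⊆ Finset.range m := by
        intro x; simp only [Finset.mem_range]; omega
      rw [← Finset.sum_subset hsub]
      · refine Finset.sum_congr rfl fun k hk => ?_
        have hk' := Finset.mem_range.1 hk
        rw [map_sum, Finset.smul_sum]
        refine Finset.sum_congr rfl fun n hn => ?_
        rw [mem_comps] at hn
        rw [Finset.prod_range_succ', tailSum_zero, Fin.sum_univ_succ]
        simp only [tailSum_cons_succ, Fin.cons_zero, Fin.cons_succ, hn.2, List.ofFn_succ,
          List.foldr_cons, map_smul, smul_smul]
        rw [show i + 1 + (m - 1 - i) = m by omega, div_mul_div_comm, ← pow_add,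
          mul_comm (m * ((r : ℂ) - m)),
          show 2 * i + 2 * (m - 1 - i - k) = 2 * (m - (k + 1)) by omega]
      · intro k hk hk'
        rw [Finset.mem_range, not_lt] at hk'
        rw [comps_eq_empty (by omega), Finset.sum_empty]
    rw [Finset.sum_congr rfl key, ← Finset.smul_sum, hf, smul_smul]
    congr 1
    rw [← mul_assoc, div_mul_eq_mul_div, ← pow_add, show 2 * (m - 1) + 2 = 2 * m by omega,
      div_mul_cancel₀ _ hmr]

theorem sum_BSAcoeff_words_eq_zero (L : ℕ → V →ₗ[ℂ] V) (f : ℕ → V) (χ : ℂ) (r : ℕ)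
    (hf : ∀ m, ∑ i ∈ Finset.range m, L (i + 1) (f (m - 1 - i)) =
      (χ ^ 2 * (m * ((r : ℂ) - m))) • f m) :
    ∑ k ∈ Finset.Icc 1 r, ∑ n ∈ comps r k, BSAcoeff r k χ n •
      (List.ofFn n).foldr (fun n v => L n v) (f 0) = 0 := by
  have hIcc : Finset.Icc 1 r = Finset.Ico (0 + 1) (r + 1) := by
    ext x; simp only [Finset.mem_Icc, Finset.mem_Ico]; omega
  rw [hIcc, ← Finset.sum_Ico_add', ← Finset.range_eq_Ico]
  simp only [sum_comps_succ]
  rw [Finset.sum_comm]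
  have key : ∀ i ∈ Finset.range r, (∑ k ∈ Finset.range r, ∑ n ∈ comps (r - 1 - i) k,
      BSAcoeff r (k + 1) χ (Fin.cons (i + 1) n) •
      (List.ofFn (Fin.cons (i + 1) n : Fin (k + 1) → ℕ)).foldr (fun n v => L n v) (f 0)) =
      χ ^ (2 * (r - 1)) • L (i + 1) (f (r - 1 - i)) := by
    intro i hi
    have hi' := Finset.mem_range.1 hi
    have h1 := congrArg (fun v => χ ^ (2 * i) • L (i + 1) v)
      (sum_words_eq L f χ r hf (r - 1 - i) (by omega))
    simp only [map_smul, smul_smul, ← pow_add] at h1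
    rw [show 2 * i + 2 * (r - 1 - i) = 2 * (r - 1) by omega] at h1
    rw [← h1, show r - 1 - i + 1 = r - i by omega, map_sum, Finset.smul_sum]
    have hsub : Finset.range (r - i) ⊆ Finset.range r := by
      intro x; simp only [Finset.mem_range]; omega
    rw [← Finset.sum_subset hsub]
    · refine Finset.sum_congr rfl fun k hk => ?_
      have hk' := Finset.mem_range.1 hk
      rw [map_sum, Finset.smul_sum]
      refine Finset.sum_congr rfl fun n hn => ?_
      rw [mem_comps] at hn
      have hn' : (Fin.cons (i + 1) n : Fin (k + 1) → ℕ) ∈ comps r (k + 1) := by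
        rw [mem_comps]
        refine ⟨fun x => Fin.cases (by simp) (fun x => by simpa using hn.1 x) x, ?_⟩
        rw [Fin.sum_univ_succ]
        simp only [Fin.cons_zero, Fin.cons_succ, hn.2]
        omega
      rw [BSAcoeff_cons χ _ n hn']
      simp only [Fin.cons_zero, Fin.cons_succ, List.ofFn_succ, List.foldr_cons, map_smul,
        smul_smul]
      rw [← mul_div_assoc, ← pow_add,
        show 2 * i + 2 * (r - 1 - i - k) = 2 * (r - (k + 1)) by omega]
    · intro k hk hk'
      rw [Finset.mem_range, not_lt] at hk'
      rw [comps_eq_empty (by omega), Finset.sum_empty]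
  rw [Finset.sum_congr rfl key, ← Finset.smul_sum, hf, sub_self, mul_zero, mul_zero, zero_smul,
    smul_zero]

end Recursion

theorem aestronglyMeasurable_of_continuousAt_of_subset {Y F : Type*} [TopologicalSpace Y]
    [T2Space Y] [MeasurableSpace Y] [BorelSpace Y] [TopologicalSpace F]
    [TopologicalSpace.PseudoMetrizableSpace F] (μ : Measure Y)
    {C S : Set Y} (hC : IsCompact C) (hSC : S ⊆ C) {g : Y → F}
    (hg : ∀ y ∈ C, ContinuousAt g y) : AEStronglyMeasurable g (μ.restrict S) := by
  have : ContinuousOn g C := fun y hy => (hg y hy).continuousWithinAt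
  exact (this.aestronglyMeasurable_of_isCompact hC hC.measurableSet).mono_measure
    (Measure.restrict_mono hSC le_rfl)

open Topology in
/-- Differentiation under the integral sign over a subset of a compact set, for a `C¹` kernel
and a bounded weight. -/
theorem hasFDerivAt_setIntegral_mul {E Y : Type*} [NormedAddCommGroup E] [NormedSpace ℝ E]
    [NormedAddCommGroup Y] [NormedSpace ℝ Y] [FiniteDimensional ℝ Y] [MeasurableSpace Y]
    [BorelSpace Y] (μ : Measure Y) [IsFiniteMeasureOnCompacts μ] {K : E × Y → ℂ} {p₀ : E}
    {C S : Set Y} (hC : IsCompact C) (hSC : S ⊆ C)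
    (hK : ∀ y ∈ C, ContDiffAt ℝ 1 K (p₀, y)) {w : Y → ℂ} (hw : Measurable w) {B : ℝ}
    (hS : MeasurableSet S) (hB : ∀ y ∈ S, ‖w y‖ ≤ B) :
    HasFDerivAt (fun p => ∫ y in S, w y * K (p, y) ∂μ)
      (∫ y in S, w y • fderiv ℝ (fun p => K (p, y)) p₀ ∂μ) p₀ ∧
    Integrable (fun y => w y • fderiv ℝ (fun p => K (p, y)) p₀) (μ.restrict S) ∧
    Integrable (fun y => w y * K (p₀, y)) (μ.restrict S) := by
  have hfin : IsFiniteMeasure (μ.restrict S) :=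
    ⟨by rw [Measure.restrict_apply_univ]; exact (measure_mono hSC).trans_lt hC.measure_lt_top⟩
  have hpart : ∀ p y, ContDiffAt ℝ 1 K (p, y) → HasFDerivAt (fun p => K (p, y))
      ((fderiv ℝ K (p, y)).comp (ContinuousLinearMap.inl ℝ E Y)) p := by
    intro p y h
    have h1 : HasFDerivAt (fun p : E => (p, y)) (ContinuousLinearMap.inl ℝ E Y) p :=
      hasFDerivAt_prodMk_left p y
    exact (h.differentiableAt one_ne_zero).hasFDerivAt.comp p h1
  have hmeas : ∀ {g : Y → ℂ},
      (∀ y ∈ C, ContinuousAt g y) → AEStronglyMeasurable g (μ.restrict S) :=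
    fun hg => aestronglyMeasurable_of_continuousAt_of_subset μ hC hSC hg
  have hwm : AEStronglyMeasurable w (μ.restrict S) := hw.aestronglyMeasurable
  have hfd : ∀ y ∈ C, ContinuousAt (fderiv ℝ K) (p₀, y) := fun y hy =>
    ((hK y hy).fderiv_right (m := 0) (by norm_num)).continuousAt
  have hmk : ∀ (p : E) (y : Y), ContinuousAt (fun y : Y => (p, y)) y :=
    fun p y => by fun_prop
  obtain ⟨M, hM⟩ := hC.exists_bound_of_continuousOn (f := fun y => fderiv ℝ K (p₀, y))
    fun y hy => (ContinuousAt.comp (g := fderiv ℝ K) (hfd y hy) (hmk p₀ y)).continuousWithinAt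
  obtain ⟨M', hM'⟩ := hC.exists_bound_of_continuousOn (f := fun y => K (p₀, y))
    fun y hy => (ContinuousAt.comp (g := K) (hK y hy).continuousAt (hmk p₀ y)).continuousWithinAt
  have hev : ∀ᶠ p in 𝓝 p₀, ∀ y ∈ C, ContDiffAt ℝ 1 K (p, y) ∧ ‖fderiv ℝ K (p, y)‖ < M + 1 := by
    apply hC.eventually_forall_of_forall_eventually
    intro y hy
    refine ((hK y hy).eventually (by simp)).and ?_
    exact (hfd y hy).norm.eventually_lt_const ((hM y hy).trans_lt (lt_add_one M))
  have hwint : Integrable (fun y => w y * K (p₀, y)) (μ.restrict S) := by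
    refine Integrable.of_bound (hwm.mul (hmeas fun y hy =>
      ContinuousAt.comp (g := K) (hK y hy).continuousAt (hmk p₀ y))) (B * M') ?_
    refine (ae_restrict_iff' hS).2 (.of_forall fun y hy => ?_)
    rw [norm_mul]
    exact mul_le_mul (hB y hy) (hM' y (hSC hy)) (norm_nonneg _) ((norm_nonneg _).trans (hB y hy))
  have hinl : ‖ContinuousLinearMap.inl ℝ E Y‖ ≤ 1 := ContinuousLinearMap.norm_inl_le_one ℝ E Y
  have hmeas' : AEStronglyMeasurable (fun y => w y • fderiv ℝ (fun p => K (p, y)) p₀)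
      (μ.restrict S) := by
    refine hwm.smul ?_
    have h1 : AEStronglyMeasurable
        (fun y => (fderiv ℝ K (p₀, y)).comp (ContinuousLinearMap.inl ℝ E Y)) (μ.restrict S) :=
      aestronglyMeasurable_of_continuousAt_of_subset μ hC hSC fun y hy =>
        ((ContinuousAt.comp (g := fderiv ℝ K) (hfd y hy) (hmk p₀ y))).clm_comp
        continuousAt_const
    refine h1.congr ((ae_restrict_iff' hS).2 (.of_forall fun y hy => ?_))
    exact ((hpart p₀ y (hK y (hSC hy))).fderiv).symm
  have hbd : ∀ y ∈ S, ∀ p, (∀ y ∈ C, ContDiffAt ℝ 1 K (p, y) ∧ ‖fderiv ℝ K (p, y)‖ < M + 1) →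
      ‖w y • fderiv ℝ (fun p => K (p, y)) p‖ ≤ B * (M + 1) := by
    intro y hy p hp
    obtain ⟨h1, h2⟩ := hp y (hSC hy)
    rw [norm_smul, (hpart p y h1).fderiv]
    refine mul_le_mul (hB y hy) ?_ (norm_nonneg _) ((norm_nonneg _).trans (hB y hy))
    refine (ContinuousLinearMap.opNorm_comp_le _ _).trans ?_
    exact (mul_le_of_le_one_right (norm_nonneg _) hinl).trans h2.le
  refine ⟨?_, ?_, hwint⟩
  · refine hasFDerivAt_integral_of_dominated_of_fderiv_le (𝕜 := ℝ) (bound := fun _ => B * (M + 1))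
      (F' := fun p y => w y • fderiv ℝ (fun p => K (p, y)) p) hev ?_ hwint hmeas' ?_
      (integrable_const _) ?_
    · filter_upwards [hev] with p hp
      exact hwm.mul (hmeas fun y hy =>
        ContinuousAt.comp (g := K) (hp y hy).1.continuousAt (hmk p y))
    · exact (ae_restrict_iff' hS).2 (.of_forall fun y hy p hp => hbd y hy p hp)
    · refine (ae_restrict_iff' hS).2 (.of_forall fun y hy p hp => ?_)
      have h := hpart p y (hp y (hSC hy)).1
      rw [h.fderiv]
      exact h.const_mul (w y)
  · exact Integrable.of_bound hmeas' (B * (M + 1)) ((ae_restrict_iff' hS).2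
      (.of_forall fun y hy => hbd y hy p₀ hev.self_of_nhds))

theorem measurableSet_Simplex (l : ℕ) (a b : ℝ) : MeasurableSet (Simplex l a b) := by
  have : Simplex l a b = (⋂ i : Fin l, ⋂ j : Fin l, {x | i < j → x i < x j}) ∩
      ⋂ s : Fin l, {x | a < x s ∧ x s < b} := by
    ext x
    simp [Simplex, StrictMono]
  rw [this]
  refine MeasurableSet.inter (MeasurableSet.iInter fun i => MeasurableSet.iInter fun j => ?_)
    (MeasurableSet.iInter fun s => ?_)
  · by_cases h : i < j
    · simpa [h] using measurableSet_lt (measurable_pi_apply i) (measurable_pi_apply j)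
    · simp [h]
  · exact (measurableSet_lt measurable_const (measurable_pi_apply s)).inter
      (measurableSet_lt (measurable_pi_apply s) measurable_const)

theorem integral_Simplex_comp {l : ℕ} {a b : ℝ} {φ φ' : ℝ → ℝ} (hab : a < b)
    (hφ : ∀ x ∈ Set.Icc a b, HasDerivAt φ (φ' x) x) (hpos : ∀ x ∈ Set.Icc a b, 0 < φ' x)
    (f : (Fin l → ℝ) → ℂ) :
    ∫ x in Simplex l (φ a) (φ b), f x =
      ∫ x in Simplex l a b, ((∏ s, φ' (x s) : ℝ) : ℂ) * f fun s => φ (x s) := by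
  have hcont : ContinuousOn φ (Set.Icc a b) := fun x hx => (hφ x hx).continuousAt.continuousWithinAt
  have hmono : StrictMonoOn φ (Set.Icc a b) := by
    refine strictMonoOn_of_deriv_pos (convex_Icc a b) hcont fun x hx => ?_
    have hx' := interior_subset hx
    rw [(hφ x hx').deriv]
    exact hpos x hx'
  have hIcc : ∀ {x : Fin l → ℝ}, x ∈ Simplex l a b → ∀ s, x s ∈ Set.Icc a b :=
    fun hx s => ⟨(hx.2 s).1.le, (hx.2 s).2.le⟩
  have ha := Set.left_mem_Icc.2 hab.le
  have hb := Set.right_mem_Icc.2 hab.le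
  have himage : (fun x : Fin l → ℝ => fun s => φ (x s)) '' Simplex l a b =
      Simplex l (φ a) (φ b) := by
    ext y
    constructor
    · rintro ⟨x, hx, rfl⟩
      exact ⟨fun i j hij => hmono (hIcc hx i) (hIcc hx j) (hx.1 hij), fun s =>
        ⟨hmono ha (hIcc hx s) (hx.2 s).1, hmono (hIcc hx s) hb (hx.2 s).2⟩⟩
    · intro hy
      have hsurj : ∀ s, ∃ x ∈ Set.Ioo a b, φ x = y s := fun s =>
        intermediate_value_Ioo hab.le hcont (hy.2 s)
      choose x hx hxy using hsurj
      refine ⟨x, ⟨fun i j hij => ?_, fun s => hx s⟩, funext hxy⟩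
      have := hy.1 hij
      rw [← hxy, ← hxy] at this
      exact (hmono.lt_iff_lt (Set.Ioo_subset_Icc_self (hx i))
        (Set.Ioo_subset_Icc_self (hx j))).1 this
  have hinj : Set.InjOn (fun x : Fin l → ℝ => fun s => φ (x s)) (Simplex l a b) :=
    fun x hx y hy h => funext fun s => hmono.injOn (hIcc hx s) (hIcc hy s) (congrFun h s)
  have hder : ∀ x ∈ Simplex l a b, HasFDerivWithinAt (fun x : Fin l → ℝ => fun s => φ (x s))
      (ContinuousLinearMap.pi fun s => (φ' (x s)) • ContinuousLinearMap.proj (R := ℝ) s)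
      (Simplex l a b) x := by
    intro x hx
    refine (hasFDerivAt_pi.2 fun s => ?_).hasFDerivWithinAt
    exact (hφ (x s) (hIcc hx s)).comp_hasFDerivAt x (hasFDerivAt_apply s x)
  rw [← himage, integral_image_eq_integral_abs_det_fderiv_smul volume
    (measurableSet_Simplex l a b) hder hinj]
  refine setIntegral_congr_fun (measurableSet_Simplex l a b) fun x hx => ?_
  have hdet : (ContinuousLinearMap.pi fun s => (φ' (x s)) •
      (ContinuousLinearMap.proj s : (Fin l → ℝ) →L[ℝ] ℝ)).det = ∏ s, φ' (x s) := by
    have : ((ContinuousLinearMap.pi fun s => (φ' (x s)) •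
      (ContinuousLinearMap.proj s : (Fin l → ℝ) →L[ℝ] ℝ)) : (Fin l → ℝ) →ₗ[ℝ] (Fin l → ℝ)) =
        Matrix.toLin' (Matrix.diagonal fun s => φ' (x s)) := by
      ext s i
      rcases eq_or_ne i s with rfl | h
      · simp
      · simp [h]
    rw [ContinuousLinearMap.det, this, LinearMap.det_toLin', Matrix.det_diagonal]
  simp only [hdet]
  rw [abs_of_pos (Finset.prod_pos fun s _ => hpos _ (hIcc hx s)), Complex.real_smul]

/-- The power sums `∑ₖ αₖ (tₖ - t)⁻ⁿ + γ ∑ₛ (xₛ - t)⁻ⁿ`. -/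
noncomputable def powerSums {N l : ℕ} (γ : ℂ) (α : Fin (N + 1) → ℂ) (p : ℝ × (Fin N → ℝ))
    (x : Fin l → ℝ) (n : ℕ) : ℂ :=
  ∑ k : Fin N, α k.succ * (((p.2 k - p.1 : ℝ) : ℂ)⁻¹) ^ n +
    ∑ s : Fin l, γ * (((x s - p.1 : ℝ) : ℂ)⁻¹) ^ n

/-- The Coulomb gas integral with a polynomial in the power sums inserted. -/
noncomputable def CoulombP (l N : ℕ) (hN : 2 ≤ N) (γ : ℂ) (α : Fin (N + 1) → ℂ)
    (P : MvPolynomial ℕ ℂ) (p : ℝ × (Fin N → ℝ)) : ℂ :=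
  (∏ i : Fin (N + 1), ∏ j ∈ Finset.Ioi i,
      (((Tfull p j - Tfull p i : ℝ) : ℂ) ^ (-(α i * α j) / 2))) *
    ∫ x in Simplex l (p.2 ⟨N - 2, by omega⟩) (p.2 ⟨N - 1, by omega⟩),
      CGint l N γ α (Tfull p) x * MvPolynomial.aeval (powerSums γ α p x) P

theorem CoulombP_one (l N : ℕ) (hN : 2 ≤ N) (γ : ℂ) (α : Fin (N + 1) → ℂ) :
    CoulombP l N hN γ α 1 = CoulombC l N hN γ α := by
  ext p
  simp [CoulombP, CoulombC]

/-- A vector field `v` on `(t, ∞)` together with its divided differences `S`. -/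
structure Transport (t : ℝ) where
  v : ℝ → ℝ
  S : ℝ → ℝ → ℝ
  sub_eq : ∀ y y', t < y → t < y' → v y - v y' = (y - y') * S y y'
  hasDerivAt_v : ∀ y, t < y → HasDerivAt v (S y y) y
  S_pos : ∀ y y', t < y → t < y' → 0 < S y y'
  contDiffAt_v : ∀ y, t < y → ContDiffAt ℝ 1 v y
  contDiffAt_S : ∀ y y', t < y → t < y' → ContDiffAt ℝ 1 (fun q : ℝ × ℝ => S q.1 q.2) (y, y')

namespace Transport

variable {N l : ℕ} {p₀ : ℝ × (Fin N → ℝ)} (V : Transport p₀.1) (L R : Fin N)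

/-- The amplitude of `v` in the deformation moving `(t_L, t_R)` as prescribed by `p`. -/
noncomputable def amp (p : ℝ × (Fin N → ℝ)) : ℝ :=
  ((p.2 R - p₀.2 R) - (p.2 L - p₀.2 L)) / (V.v (p₀.2 R) - V.v (p₀.2 L))

/-- The translation part of the deformation. -/
noncomputable def shift (p : ℝ × (Fin N → ℝ)) : ℝ :=
  (p.2 L - p₀.2 L) - V.amp L R p * V.v (p₀.2 L)

/-- A deformation of the line mapping `t_L, t_R` at `p₀` to `t_L, t_R` at `p`. -/
noncomputable def map (p : ℝ × (Fin N → ℝ)) (y : ℝ) : ℝ :=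
  y + V.amp L R p * V.v y + V.shift L R p

/-- The ratio of `x - T_i` after and before the deformation. -/
noncomputable def ratio (p : ℝ × (Fin N → ℝ)) (y : ℝ) (i : Fin (N + 1)) : ℝ :=
  Fin.cases ((V.map L R p y - p.1) / (y - p₀.1))
    (fun k => if k = L ∨ k = R then 1 + V.amp L R p * V.S y (p₀.2 k)
      else (V.map L R p y - p.2 k) / (y - p₀.2 k)) i

theorem amp_self : V.amp L R p₀ = 0 := by simp [amp]

theorem shift_self : V.shift L R p₀ = 0 := by simp [shift, amp_self]

theorem map_self (y : ℝ) : V.map L R p₀ y = y := by simp [map, amp_self, shift_self]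

theorem map_sub_map (p : ℝ × (Fin N → ℝ)) {y y' : ℝ} (hy : p₀.1 < y) (hy' : p₀.1 < y') :
    V.map L R p y - V.map L R p y' = (y - y') * (1 + V.amp L R p * V.S y y') := by
  have := V.sub_eq y y' hy hy'
  simp only [map]
  linear_combination V.amp L R p * this

theorem map_left (p : ℝ × (Fin N → ℝ)) : V.map L R p (p₀.2 L) = p.2 L := by
  simp only [map, shift]; ring

theorem v_lt {y y' : ℝ} (hy : p₀.1 < y) (h : y < y') : V.v y < V.v y' := by
  have h1 := V.sub_eq y' y (hy.trans h) hy
  have h2 := mul_pos (sub_pos.2 h) (V.S_pos y' y (hy.trans h) hy)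
  linarith

theorem map_right (hL : p₀.1 < p₀.2 L) (hLR : p₀.2 L < p₀.2 R) (p : ℝ × (Fin N → ℝ)) :
    V.map L R p (p₀.2 R) = p.2 R := by
  have h : V.v (p₀.2 R) - V.v (p₀.2 L) ≠ 0 := (sub_pos.2 (V.v_lt hL hLR)).ne'
  have h2 : V.amp L R p * (V.v (p₀.2 R) - V.v (p₀.2 L)) =
      (p.2 R - p₀.2 R) - (p.2 L - p₀.2 L) := div_mul_cancel₀ _ h
  simp only [map, shift]
  linear_combination h2

theorem hasDerivAt_map (p : ℝ × (Fin N → ℝ)) {y : ℝ} (hy : p₀.1 < y) :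
    HasDerivAt (V.map L R p) (1 + V.amp L R p * V.S y y) y :=
  ((hasDerivAt_id y).add ((V.hasDerivAt_v y hy).const_mul _)).add_const _

theorem contDiff_amp : ContDiff ℝ 1 (V.amp L R) := by
  unfold amp; fun_prop

theorem contDiff_shift : ContDiff ℝ 1 (V.shift L R) := by
  have := V.contDiff_amp L R
  unfold shift; fun_prop

theorem contDiffAt_map {E : Type*} [NormedAddCommGroup E] [NormedSpace ℝ E]
    {f : E → ℝ × (Fin N → ℝ)} {g : E → ℝ} {e : E} (hf : ContDiffAt ℝ 1 f e)
    (hg : ContDiffAt ℝ 1 g e) (hy : p₀.1 < g e) :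
    ContDiffAt ℝ 1 (fun e => V.map L R (f e) (g e)) e := by
  have h1 := (V.contDiff_amp L R).contDiffAt.comp e hf
  have h2 := (V.contDiff_shift L R).contDiffAt.comp e hf
  have h3 := (V.contDiffAt_v (g e) hy).comp e hg
  exact (hg.add (h1.mul h3)).add h2

theorem contDiffAt_one_add {E : Type*} [NormedAddCommGroup E] [NormedSpace ℝ E]
    {f : E → ℝ × (Fin N → ℝ)} {g g' : E → ℝ} {e : E} (hf : ContDiffAt ℝ 1 f e)
    (hg : ContDiffAt ℝ 1 g e) (hg' : ContDiffAt ℝ 1 g' e) (hy : p₀.1 < g e)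
    (hy' : p₀.1 < g' e) :
    ContDiffAt ℝ 1 (fun e => 1 + V.amp L R (f e) * V.S (g e) (g' e)) e := by
  have h1 := (V.contDiff_amp L R).contDiffAt.comp e hf
  have h3 := ContDiffAt.comp (g := fun q : ℝ × ℝ => V.S q.1 q.2) e
    (V.contDiffAt_S (g e) (g' e) hy hy') (hg.prodMk hg')
  exact contDiffAt_const.add (h1.mul h3)

theorem ratio_self {y : ℝ} (i : Fin (N + 1)) (hy : p₀.1 < y)
    (h : ∀ k, k ≠ L → k ≠ R → y ≠ p₀.2 k) : V.ratio L R p₀ y i = 1 := by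
  refine Fin.cases ?_ (fun k => ?_) i
  · simp only [ratio, Fin.cases_zero, map_self]
    exact div_self (sub_pos.2 hy).ne'
  · simp only [ratio, Fin.cases_succ, map_self, amp_self, zero_mul, add_zero]
    split_ifs with hk
    · rfl
    · rw [not_or] at hk
      exact div_self (sub_ne_zero.2 (h k hk.1 hk.2))

theorem contDiffAt_ratio {E : Type*} [NormedAddCommGroup E] [NormedSpace ℝ E]
    {f : E → ℝ × (Fin N → ℝ)} {g : E → ℝ} {e : E} (hf : ContDiffAt ℝ 1 f e)
    (hg : ContDiffAt ℝ 1 g e) (hy : p₀.1 < g e) (hp : ∀ k, p₀.1 < p₀.2 k)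
    (h : ∀ k, k ≠ L → k ≠ R → g e ≠ p₀.2 k) (i : Fin (N + 1)) :
    ContDiffAt ℝ 1 (fun e => V.ratio L R (f e) (g e) i) e := by
  have hm := V.contDiffAt_map L R hf hg hy
  refine Fin.cases ?_ (fun k => ?_) i
  · simp only [ratio, Fin.cases_zero]
    exact (hm.sub hf.fst).div (hg.sub contDiffAt_const) (sub_pos.2 hy).ne'
  · simp only [ratio, Fin.cases_succ]
    split_ifs with hk
    · exact V.contDiffAt_one_add L R hf hg contDiffAt_const hy (hp k)
    · rw [not_or] at hk
      refine (hm.sub ?_).div (hg.sub contDiffAt_const) (sub_ne_zero.2 (h k hk.1 hk.2))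
      exact (contDiff_apply ℝ ℝ k).contDiffAt.comp e hf.snd

/-- The deformation changes `x - T_i` by the factor `ratio`. -/
theorem map_sub_Tfull (hL : p₀.1 < p₀.2 L) (hLR : p₀.2 L < p₀.2 R) (p : ℝ × (Fin N → ℝ)) {y : ℝ}
    (hy : p₀.1 < y) (h : ∀ k, k ≠ L → k ≠ R → y ≠ p₀.2 k) (i : Fin (N + 1)) :
    V.map L R p y - Tfull p i = (y - Tfull p₀ i) * V.ratio L R p y i := by
  refine Fin.cases ?_ (fun k => ?_) i
  · simp only [ratio, Fin.cases_zero, Tfull, Fin.cons_zero]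
    rw [mul_div_cancel₀ _ (sub_pos.2 hy).ne']
  · simp only [ratio, Fin.cases_succ, Tfull, Fin.cons_succ]
    split_ifs with hk
    · rcases hk with rfl | rfl
      · rw [← V.map_sub_map k R p hy hL, map_left]
      · rw [← V.map_sub_map L k p hy (hL.trans hLR), V.map_right L k hL hLR]
    · rw [not_or] at hk
      rw [mul_div_cancel₀ _ (sub_ne_zero.2 (h k hk.1 hk.2))]

/-- The logarithm of the factor by which the deformation changes the integrand. -/
noncomputable def logFactor (γ : ℂ) (α : Fin (N + 1) → ℂ) (p : ℝ × (Fin N → ℝ))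
    (x : Fin l → ℝ) : ℂ :=
  ∑ i : Fin (N + 1), ∑ j ∈ Finset.Ioi i,
      (-(α i * α j) / 2) * (Real.log (Tfull p j - Tfull p i) : ℂ) +
    ∑ s : Fin l, ∑ i : Fin (N + 1), (-(γ * α i) / 2) * (Real.log (V.ratio L R p (x s) i) : ℂ) +
    ∑ s : Fin l, ∑ s' ∈ Finset.Iio s,
      (-(γ ^ 2) / 2) * (Real.log (1 + V.amp L R p * V.S (x s) (x s')) : ℂ) +
    ∑ s : Fin l, (Real.log (1 + V.amp L R p * V.S (x s) (x s)) : ℂ)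

/-- The integrand after the deformation, relative to `CGint` at `p₀`. -/
noncomputable def kernel (γ : ℂ) (α : Fin (N + 1) → ℂ) (P : MvPolynomial ℕ ℂ)
    (q : (ℝ × (Fin N → ℝ)) × (Fin l → ℝ)) : ℂ :=
  Complex.exp (V.logFactor L R γ α q.1 q.2) *
    MvPolynomial.aeval (powerSums γ α q.1 fun s => V.map L R q.1 (q.2 s)) P

end Transport

theorem ofReal_mul_cpow_eq {x ρ : ℝ} (hx : x ≠ 0) (hρ : 0 < ρ) (c : ℂ) :
    ((x * ρ : ℝ) : ℂ) ^ c = (x : ℂ) ^ c * Complex.exp (c * (Real.log ρ : ℂ)) := by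
  have h1 : ((x * ρ : ℝ) : ℂ) ≠ 0 := by exact_mod_cast mul_ne_zero hx hρ.ne'
  have h2 : (x : ℂ) ≠ 0 := by exact_mod_cast hx
  rw [Complex.cpow_def_of_ne_zero h1, Complex.cpow_def_of_ne_zero h2, ← Complex.exp_add,
    Complex.ofReal_mul, mul_comm (x : ℂ), Complex.log_ofReal_mul hρ h2]
  congr 1
  ring

theorem eventually_mem_OrdDomain {N : ℕ} {p₀ : ℝ × (Fin N → ℝ)} (hp₀ : p₀ ∈ OrdDomain N) :
    ∀ᶠ p in nhds p₀, p ∈ OrdDomain N := by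
  have h1 : ∀ᶠ p : ℝ × (Fin N → ℝ) in nhds p₀, ∀ k, p.1 < p.2 k := by
    refine Filter.eventually_all.2 fun k => ?_
    exact ContinuousAt.eventually_lt (by fun_prop) (by fun_prop) (hp₀.1 k)
  have h2 : ∀ᶠ p : ℝ × (Fin N → ℝ) in nhds p₀, ∀ i j, i < j → p.2 i < p.2 j := by
    refine Filter.eventually_all.2 fun i => Filter.eventually_all.2 fun j => ?_
    refine Filter.eventually_imp_distrib_left.2 fun hij => ?_
    exact ContinuousAt.eventually_lt (by fun_prop) (by fun_prop) (hp₀.2 hij)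
  filter_upwards [h1, h2] with p h1 h2 using ⟨h1, fun i j => h2 i j⟩

theorem Tfull_strictMono {N : ℕ} {p : ℝ × (Fin N → ℝ)} (hp : p ∈ OrdDomain N) :
    StrictMono (Tfull p) := by
  intro i j
  refine Fin.cases ?_ (fun k => ?_) i <;> refine Fin.cases ?_ (fun k' => ?_) j
  · exact fun h => absurd h (lt_irrefl _)
  · exact fun _ => hp.1 k'
  · exact fun h => absurd h (Fin.not_lt_zero _)
  · exact fun h => hp.2 (Fin.succ_lt_succ_iff.1 h)

namespace Transport

variable {N l : ℕ} {p₀ : ℝ × (Fin N → ℝ)} (V : Transport p₀.1) (L R : Fin N)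

theorem eventually_one_add_pos (hL : p₀.1 < p₀.2 L) :
    ∀ᶠ p in nhds p₀, ∀ y ∈ Set.Icc (p₀.2 L) (p₀.2 R), ∀ y' ∈ Set.Icc (p₀.2 L) (p₀.2 R),
      0 < 1 + V.amp L R p * V.S y y' := by
  have hK : IsCompact (Set.Icc (p₀.2 L) (p₀.2 R) ×ˢ Set.Icc (p₀.2 L) (p₀.2 R)) :=
    isCompact_Icc.prod isCompact_Icc
  have := hK.eventually_forall_of_forall_eventually (x₀ := p₀)
    (P := fun p q => 0 < 1 + V.amp L R p * V.S q.1 q.2) fun q hq => by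
      have hc := (V.contDiffAt_one_add L R (e := (p₀, q))
        (f := fun e : (ℝ × (Fin N → ℝ)) × (ℝ × ℝ) => e.1) (g := fun e => e.2.1)
        (g' := fun e => e.2.2) (by fun_prop) (by fun_prop) (by fun_prop)
        (hL.trans_le hq.1.1) (hL.trans_le hq.2.1)).continuousAt
      refine hc.eventually (lt_mem_nhds ?_)
      simp [amp_self]
  filter_upwards [this] with p h y hy y' hy' using h (y, y') ⟨hy, hy'⟩

theorem map_lt_map {p : ℝ × (Fin N → ℝ)} (hL : p₀.1 < p₀.2 L)
    (hJ : ∀ y ∈ Set.Icc (p₀.2 L) (p₀.2 R), ∀ y' ∈ Set.Icc (p₀.2 L) (p₀.2 R),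
      0 < 1 + V.amp L R p * V.S y y') {y y' : ℝ} (hy : y ∈ Set.Icc (p₀.2 L) (p₀.2 R))
    (hy' : y' ∈ Set.Icc (p₀.2 L) (p₀.2 R)) (h : y' < y) :
    V.map L R p y' < V.map L R p y := by
  have := V.map_sub_map L R p (hL.trans_le hy.1) (hL.trans_le hy'.1)
  have := mul_pos (sub_pos.2 h) (hJ y hy y' hy')
  linarith

theorem ratio_pos (hp₀ : p₀ ∈ OrdDomain N) {L R : Fin N} (hLR : L < R)
    (hadj : ∀ k, k ≠ L → k ≠ R → k < L) {p : ℝ × (Fin N → ℝ)} (hp : p ∈ OrdDomain N)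
    (hJ : ∀ y ∈ Set.Icc (p₀.2 L) (p₀.2 R), ∀ y' ∈ Set.Icc (p₀.2 L) (p₀.2 R),
      0 < 1 + V.amp L R p * V.S y y') {y : ℝ} (hy : y ∈ Set.Ioo (p₀.2 L) (p₀.2 R))
    (i : Fin (N + 1)) : 0 < V.ratio L R p y i := by
  have hL := hp₀.1 L
  have hLR' := hp₀.2 hLR
  have hyI := Set.Ioo_subset_Icc_self hy
  have hm : p.2 L < V.map L R p y := by
    rw [← V.map_left L R p]
    exact V.map_lt_map L R hL hJ hyI (Set.left_mem_Icc.2 hLR'.le) hy.1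
  refine Fin.cases ?_ (fun k => ?_) i
  · exact div_pos (by linarith [hp.1 L]) (by linarith [hy.1])
  · simp only [ratio, Fin.cases_succ]
    split_ifs with hk
    · rcases hk with rfl | rfl
      · exact hJ y hyI _ (Set.left_mem_Icc.2 hLR'.le)
      · exact hJ y hyI _ (Set.right_mem_Icc.2 hLR'.le)
    · rw [not_or] at hk
      have hkL := hadj k hk.1 hk.2
      exact div_pos (by linarith [hp.2 hkL]) (by linarith [hp₀.2 hkL, hy.1])

theorem ne_of_adjacent (hp₀ : p₀ ∈ OrdDomain N) {L R : Fin N}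
    (hadj : ∀ k, k ≠ L → k ≠ R → k < L) {y : ℝ} (hy : p₀.2 L ≤ y) (k : Fin N) (hk : k ≠ L)
    (hk' : k ≠ R) : y ≠ p₀.2 k :=
  ((hp₀.2 (hadj k hk hk')).trans_le hy).ne'

theorem sub_Tfull_ne_zero (hp₀ : p₀ ∈ OrdDomain N) {L R : Fin N}
    (hadj : ∀ k, k ≠ L → k ≠ R → k < L) {y : ℝ} (hy : y ∈ Set.Ioo (p₀.2 L) (p₀.2 R))
    (i : Fin (N + 1)) : y - Tfull p₀ i ≠ 0 := by
  refine sub_ne_zero.2 (Fin.cases ((hp₀.1 L).trans hy.1).ne' (fun k => ?_) i)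
  simp only [Tfull, Fin.cons_succ]
  by_cases h : k = L
  · exact h ▸ hy.1.ne'
  by_cases h' : k = R
  · exact h' ▸ hy.2.ne
  exact ne_of_adjacent hp₀ hadj hy.1.le k h h'

theorem mul_CGint_map (γ : ℂ) (α : Fin (N + 1) → ℂ) (hp₀ : p₀ ∈ OrdDomain N) {L R : Fin N}
    (hLR : L < R) (hadj : ∀ k, k ≠ L → k ≠ R → k < L) {p : ℝ × (Fin N → ℝ)}
    (hp : p ∈ OrdDomain N)
    (hJ : ∀ y ∈ Set.Icc (p₀.2 L) (p₀.2 R), ∀ y' ∈ Set.Icc (p₀.2 L) (p₀.2 R),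
      0 < 1 + V.amp L R p * V.S y y') {x : Fin l → ℝ}
    (hx : x ∈ Simplex l (p₀.2 L) (p₀.2 R)) :
    (∏ i : Fin (N + 1), ∏ j ∈ Finset.Ioi i,
      (((Tfull p j - Tfull p i : ℝ) : ℂ) ^ (-(α i * α j) / 2))) *
      ((∏ s, (1 + V.amp L R p * V.S (x s) (x s)) : ℝ) : ℂ) *
      CGint l N γ α (Tfull p) (fun s => V.map L R p (x s)) =
    CGint l N γ α (Tfull p₀) x * Complex.exp (V.logFactor L R γ α p x) := by
  have hL := hp₀.1 L
  have hxI : ∀ s, x s ∈ Set.Icc (p₀.2 L) (p₀.2 R) := fun s => ⟨(hx.2 s).1.le, (hx.2 s).2.le⟩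
  have hxt : ∀ s, p₀.1 < x s := fun s => hL.trans (hx.2 s).1
  have e1 : (∏ i : Fin (N + 1), ∏ j ∈ Finset.Ioi i,
      (((Tfull p j - Tfull p i : ℝ) : ℂ) ^ (-(α i * α j) / 2))) =
      Complex.exp (∑ i : Fin (N + 1), ∑ j ∈ Finset.Ioi i,
        (-(α i * α j) / 2) * (Real.log (Tfull p j - Tfull p i) : ℂ)) := by
    simp only [Complex.exp_sum]
    refine Finset.prod_congr rfl fun i _ => Finset.prod_congr rfl fun j hj => ?_
    have h : 0 < Tfull p j - Tfull p i :=
      sub_pos.2 (Tfull_strictMono hp (Finset.mem_Ioi.1 hj))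
    rw [Complex.cpow_def_of_ne_zero (by exact_mod_cast h.ne'), Complex.ofReal_log h.le, mul_comm]
  have e2 : (∏ s : Fin l, ∏ i : Fin (N + 1),
      (((V.map L R p (x s) - Tfull p i : ℝ) : ℂ) ^ (-(γ * α i) / 2))) =
      (∏ s : Fin l, ∏ i : Fin (N + 1), (((x s - Tfull p₀ i : ℝ) : ℂ) ^ (-(γ * α i) / 2))) *
      Complex.exp (∑ s : Fin l, ∑ i : Fin (N + 1),
        (-(γ * α i) / 2) * (Real.log (V.ratio L R p (x s) i) : ℂ)) := by
    simp only [Complex.exp_sum, ← Finset.prod_mul_distrib]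
    refine Finset.prod_congr rfl fun s _ => Finset.prod_congr rfl fun i _ => ?_
    rw [V.map_sub_Tfull L R hL (hp₀.2 hLR) p (hxt s)
      (ne_of_adjacent hp₀ hadj (hxI s).1) i]
    exact ofReal_mul_cpow_eq (sub_Tfull_ne_zero hp₀ hadj (hx.2 s) i)
      (V.ratio_pos hp₀ hLR hadj hp hJ (hx.2 s) i) _
  have e3 : (∏ s : Fin l, ∏ s' ∈ Finset.Iio s,
      (((V.map L R p (x s) - V.map L R p (x s') : ℝ) : ℂ) ^ (-(γ ^ 2) / 2))) =
      (∏ s : Fin l, ∏ s' ∈ Finset.Iio s, (((x s - x s' : ℝ) : ℂ) ^ (-(γ ^ 2) / 2))) *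
      Complex.exp (∑ s : Fin l, ∑ s' ∈ Finset.Iio s,
        (-(γ ^ 2) / 2) * (Real.log (1 + V.amp L R p * V.S (x s) (x s')) : ℂ)) := by
    simp only [Complex.exp_sum, ← Finset.prod_mul_distrib]
    refine Finset.prod_congr rfl fun s _ => Finset.prod_congr rfl fun s' hs' => ?_
    rw [V.map_sub_map L R p (hxt s) (hxt s')]
    exact ofReal_mul_cpow_eq (sub_pos.2 (hx.1 (Finset.mem_Iio.1 hs'))).ne'
      (hJ _ (hxI s) _ (hxI s')) _
  have e4 : ((∏ s, (1 + V.amp L R p * V.S (x s) (x s)) : ℝ) : ℂ) =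
      Complex.exp (∑ s : Fin l, (Real.log (1 + V.amp L R p * V.S (x s) (x s)) : ℂ)) := by
    rw [Complex.exp_sum, Complex.ofReal_prod]
    refine Finset.prod_congr rfl fun s _ => ?_
    rw [← Complex.ofReal_exp, Real.exp_log (hJ _ (hxI s) _ (hxI s))]
  rw [CGint, CGint, logFactor, e1, e2, e3, e4, Complex.exp_add, Complex.exp_add, Complex.exp_add]
  ring

/-- After the deformation the domain of integration no longer depends on the parameters. -/
theorem eventually_CoulombP_eq (hN : 2 ≤ N) (γ : ℂ) (α : Fin (N + 1) → ℂ)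
    (P : MvPolynomial ℕ ℂ) (hp₀ : p₀ ∈ OrdDomain N) :
    ∀ᶠ p in nhds p₀, CoulombP l N hN γ α P p =
      ∫ x in Simplex l (p₀.2 ⟨N - 2, by omega⟩) (p₀.2 ⟨N - 1, by omega⟩),
        CGint l N γ α (Tfull p₀) x *
          V.kernel ⟨N - 2, by omega⟩ ⟨N - 1, by omega⟩ γ α P (p, x) := by
  obtain ⟨L, hLdef⟩ : ∃ L : Fin N, L = ⟨N - 2, by omega⟩ := ⟨_, rfl⟩
  obtain ⟨R, hRdef⟩ : ∃ R : Fin N, R = ⟨N - 1, by omega⟩ := ⟨_, rfl⟩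
  have hLR : L < R := by simp only [hLdef, hRdef, Fin.mk_lt_mk]; omega
  have hadj : ∀ k, k ≠ L → k ≠ R → k < L := by
    intro k h1 h2
    simp only [hLdef, hRdef, ne_eq, Fin.ext_iff, Fin.lt_def] at *
    omega
  simp only [CoulombP, ← hLdef, ← hRdef]
  have hL := hp₀.1 L
  filter_upwards [eventually_mem_OrdDomain hp₀, V.eventually_one_add_pos L R hL] with p hp hJ
  have h := integral_Simplex_comp (l := l) (hp₀.2 hLR)
    (fun y hy => V.hasDerivAt_map L R p (hL.trans_le hy.1)) (fun y hy => hJ y hy y hy)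
    (fun x => CGint l N γ α (Tfull p) x * MvPolynomial.aeval (powerSums γ α p x) P)
  rw [map_left, V.map_right L R hL (hp₀.2 hLR)] at h
  rw [h, ← integral_const_mul]
  refine setIntegral_congr_fun (measurableSet_Simplex _ _ _) fun x hx => ?_
  simp only [kernel]
  rw [← mul_assoc, ← mul_assoc, ← mul_assoc, V.mul_CGint_map γ α hp₀ hLR hadj hp hJ hx]

end Transport

theorem contDiffAt_aeval {σ E : Type*} [NormedAddCommGroup E] [NormedSpace ℝ E] {f : E → σ → ℂ}
    {e : E} (hf : ∀ n, ContDiffAt ℝ 1 (fun e => f e n) e) (P : MvPolynomial σ ℂ) :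
    ContDiffAt ℝ 1 (fun e => MvPolynomial.aeval (f e) P) e := by
  induction P using MvPolynomial.induction_on with
  | C c => simpa only [MvPolynomial.aeval_C] using contDiffAt_const
  | add P Q hP hQ => simpa only [map_add] using hP.add hQ
  | mul_X P n hP => simpa only [map_mul, MvPolynomial.aeval_X] using hP.mul (hf n)

theorem contDiffAt_ofReal_log {E : Type*} [NormedAddCommGroup E] [NormedSpace ℝ E] {f : E → ℝ}
    {e : E} (hf : ContDiffAt ℝ 1 f e) (h : f e ≠ 0) :
    ContDiffAt ℝ 1 (fun e => (Real.log (f e) : ℂ)) e :=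
  Complex.ofRealCLM.contDiff.contDiffAt.comp e (hf.log h)

theorem contDiffAt_ofReal_inv {E : Type*} [NormedAddCommGroup E] [NormedSpace ℝ E] {f : E → ℝ}
    {e : E} (hf : ContDiffAt ℝ 1 f e) (h : f e ≠ 0) :
    ContDiffAt ℝ 1 (fun e => ((f e : ℝ) : ℂ)⁻¹) e := by
  refine (Complex.ofRealCLM.contDiff.contDiffAt.comp e (hf.inv h)).congr_of_eventuallyEq
    (.of_forall fun e => ?_)
  simp

namespace Transport

variable {N l : ℕ} {p₀ : ℝ × (Fin N → ℝ)} (V : Transport p₀.1) (L R : Fin N)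

theorem contDiffAt_kernel (γ : ℂ) (α : Fin (N + 1) → ℂ) (P : MvPolynomial ℕ ℂ)
    (hp₀ : p₀ ∈ OrdDomain N) {L R : Fin N} (hadj : ∀ k, k ≠ L → k ≠ R → k < L)
    {x : Fin l → ℝ} (hx : ∀ s, p₀.2 L ≤ x s) :
    ContDiffAt ℝ 1 (V.kernel L R γ α P) (p₀, x) := by
  have hxt : ∀ s, p₀.1 < x s := fun s => (hp₀.1 L).trans_le (hx s)
  have hg : ∀ s, ContDiffAt ℝ 1
      (fun q : (ℝ × (Fin N → ℝ)) × (Fin l → ℝ) => q.2 s) (p₀, x) := fun s =>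
    (contDiff_apply ℝ ℝ s).contDiffAt.comp _ contDiffAt_snd
  have hT : ∀ i, ContDiffAt ℝ 1
      (fun q : (ℝ × (Fin N → ℝ)) × (Fin l → ℝ) => Tfull q.1 i) (p₀, x) := by
    refine fun i => Fin.cases ?_ (fun k => ?_) i
    · exact contDiffAt_fst.fst
    · exact (contDiff_apply ℝ ℝ k).contDiffAt.comp _ contDiffAt_fst.snd
  have hm : ∀ s, ContDiffAt ℝ 1
      (fun q : (ℝ × (Fin N → ℝ)) × (Fin l → ℝ) => V.map L R q.1 (q.2 s)) (p₀, x) := fun s =>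
    V.contDiffAt_map L R contDiffAt_fst (hg s) (hxt s)
  refine (ContDiffAt.cexp ?_).mul (contDiffAt_aeval (fun n => ?_) P)
  · refine ((ContDiffAt.add ?_ ?_).add ?_).add ?_
    · refine ContDiffAt.sum fun i _ => ContDiffAt.sum fun j hj => contDiffAt_const.mul ?_
      exact contDiffAt_ofReal_log ((hT j).sub (hT i))
        (sub_pos.2 (Tfull_strictMono hp₀ (Finset.mem_Ioi.1 hj))).ne'
    · refine ContDiffAt.sum fun s _ => ContDiffAt.sum fun i _ => contDiffAt_const.mul ?_
      have hne := fun k hk hk' => ne_of_adjacent hp₀ hadj (hx s) k hk hk'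
      refine contDiffAt_ofReal_log
        (V.contDiffAt_ratio L R contDiffAt_fst (hg s) (hxt s) hp₀.1 hne i) ?_
      simp [V.ratio_self L R i (hxt s) hne]
    · refine ContDiffAt.sum fun s _ => ContDiffAt.sum fun s' _ => contDiffAt_const.mul ?_
      refine contDiffAt_ofReal_log
        (V.contDiffAt_one_add L R contDiffAt_fst (hg s) (hg s') (hxt s) (hxt s')) ?_
      simp [amp_self]
    · refine ContDiffAt.sum fun s _ => ?_
      refine contDiffAt_ofReal_log
        (V.contDiffAt_one_add L R contDiffAt_fst (hg s) (hg s) (hxt s) (hxt s)) ?_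
      simp [amp_self]
  · refine (ContDiffAt.sum fun k _ => contDiffAt_const.mul (ContDiffAt.pow ?_ n)).add
      (ContDiffAt.sum fun s _ => contDiffAt_const.mul (ContDiffAt.pow ?_ n))
    · exact contDiffAt_ofReal_inv ((hT k.succ).sub (hT 0)) (sub_pos.2 (hp₀.1 k)).ne'
    · refine contDiffAt_ofReal_inv ((hm s).sub (hT 0)) ?_
      simpa [map_self, Tfull, sub_eq_zero] using (hxt s).ne'

end Transport

theorem measurable_CGint (l N : ℕ) (γ : ℂ) (α : Fin (N + 1) → ℂ) (T : Fin (N + 1) → ℝ) :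
    Measurable (CGint l N γ α T) := by
  unfold CGint
  refine Measurable.mul ?_ ?_
  · refine Finset.measurable_fun_prod _ fun s _ => Finset.measurable_fun_prod _ fun i _ => ?_
    exact Measurable.pow_const (by fun_prop) _
  · refine Finset.measurable_fun_prod _ fun s _ => Finset.measurable_fun_prod _ fun i _ => ?_
    exact Measurable.pow_const (by fun_prop) _

theorem exists_bound_ofReal_sub_cpow {a T : ℝ} {c : ℂ} (b : ℝ)
    (h : (c.im = 0 ∧ 0 ≤ c.re) ∨ T < a) :
    ∃ B, 0 ≤ B ∧ ∀ y ∈ Set.Icc a b, ‖((y - T : ℝ) : ℂ) ^ c‖ ≤ B := by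
  have hcont : ContinuousOn (fun y : ℝ => |y - T| ^ c.re) (Set.Icc a b) := by
    intro y hy
    refine ContinuousAt.continuousWithinAt (ContinuousAt.rpow_const (by fun_prop) ?_)
    rcases h with h | h
    · exact .inr h.2
    · exact .inl (abs_pos.2 (sub_ne_zero.2 (h.trans_le hy.1).ne')).ne'
  obtain ⟨B, hB⟩ := isCompact_Icc.exists_bound_of_continuousOn hcont
  refine ⟨max B 0, le_max_right _ _, fun y hy => le_trans ?_ ((hB y hy).trans (le_max_left _ _))⟩
  rw [Real.norm_of_nonneg (by positivity)]
  rcases h with h | h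
  · have := Complex.norm_cpow_le ((y - T : ℝ) : ℂ) c
    simpa [h.1, -Complex.ofReal_sub] using this
  · have h0 : 0 < y - T := sub_pos.2 (h.trans_le hy.1)
    rw [Complex.norm_cpow_eq_rpow_re_of_pos h0, abs_of_pos h0]

theorem exists_bound_CGint {l N : ℕ} {γ : ℂ} {α : Fin (N + 1) → ℂ} {p₀ : ℝ × (Fin N → ℝ)}
    (hp₀ : p₀ ∈ OrdDomain N) {L R : Fin N} (hadj : ∀ k, k ≠ L → k ≠ R → k < L)
    (hγ : (-(γ ^ 2) / 2).im = 0 ∧ 0 ≤ (-(γ ^ 2) / 2).re)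
    (hαL : (-(γ * α L.succ) / 2).im = 0 ∧ 0 ≤ (-(γ * α L.succ) / 2).re)
    (hαR : (-(γ * α R.succ) / 2).im = 0 ∧ 0 ≤ (-(γ * α R.succ) / 2).re) :
    ∃ B, ∀ x ∈ Simplex l (p₀.2 L) (p₀.2 R), ‖CGint l N γ α (Tfull p₀) x‖ ≤ B := by
  have h1 : ∀ i, ∃ B, 0 ≤ B ∧ ∀ y ∈ Set.Icc (p₀.2 L) (p₀.2 R),
      ‖((y - Tfull p₀ i : ℝ) : ℂ) ^ (-(γ * α i) / 2)‖ ≤ B := by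
    refine fun i => exists_bound_ofReal_sub_cpow _ ?_
    refine Fin.cases (.inr (hp₀.1 L)) (fun k => ?_) i
    by_cases hL : k = L
    · exact .inl (hL ▸ hαL)
    by_cases hR : k = R
    · exact .inl (hR ▸ hαR)
    · exact .inr (hp₀.2 (hadj k hL hR))
  choose B hB0 hB using h1
  obtain ⟨D, hD0, hD⟩ := exists_bound_ofReal_sub_cpow (a := 0) (T := 0)
    (p₀.2 R - p₀.2 L) (.inl hγ)
  refine ⟨(∏ _s : Fin l, ∏ i, B i) * ∏ s : Fin l, ∏ _s' ∈ Finset.Iio s, D, fun x hx => ?_⟩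
  rw [CGint, norm_mul, norm_prod, norm_prod]
  simp only [norm_prod]
  have hxI : ∀ s, x s ∈ Set.Icc (p₀.2 L) (p₀.2 R) := fun s => ⟨(hx.2 s).1.le, (hx.2 s).2.le⟩
  refine mul_le_mul
    (Finset.prod_le_prod (fun s _ => Finset.prod_nonneg fun _ _ => norm_nonneg _) fun s _ =>
      Finset.prod_le_prod (fun _ _ => norm_nonneg _) fun i _ => hB i _ (hxI s))
    (Finset.prod_le_prod (fun s _ => Finset.prod_nonneg fun _ _ => norm_nonneg _) fun s _ =>
      Finset.prod_le_prod (fun _ _ => norm_nonneg _) fun s' hs' => ?_)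
    (Finset.prod_nonneg fun s _ => Finset.prod_nonneg fun _ _ => norm_nonneg _)
    (Finset.prod_nonneg fun s _ => Finset.prod_nonneg fun i _ => hB0 i)
  have := hx.1 (Finset.mem_Iio.1 hs')
  simpa only [sub_zero] using hD (x s - x s')
    ⟨by linarith, by linarith [(hxI s).2, (hxI s').1]⟩

theorem sum_sum_eq_diag_add_Ioi {m : ℕ} (f : Fin m → Fin m → ℂ) (hf : ∀ i j, f i j = f j i) :
    ∑ i, ∑ j, f i j = ∑ i, f i i + 2 * ∑ i, ∑ j ∈ Finset.Ioi i, f i j := by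
  have h1 : ∑ i, ∑ j ∈ Finset.Iio i, f i j = ∑ i, ∑ j ∈ Finset.Ioi i, f i j := by
    rw [Finset.sum_comm' (t' := Finset.univ) (s' := fun j => Finset.Ioi j) (by simp)]
    exact Finset.sum_congr rfl fun i _ => Finset.sum_congr rfl fun j _ => hf j i
  have h2 : ∀ i, ∑ j, f i j = f i i + (∑ j ∈ Finset.Iio i, f i j + ∑ j ∈ Finset.Ioi i, f i j) := by
    intro i
    rw [← Finset.sum_filter_add_sum_filter_not Finset.univ (fun j => j < i)]
    have e1 : Finset.univ.filter (fun j => j < i) = Finset.Iio i := by ext; simp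
    have e2 : Finset.univ.filter (fun j => ¬ j < i) = insert i (Finset.Ioi i) := by
      ext j; simp [le_iff_eq_or_lt]
    rw [e1, e2, Finset.sum_insert (by simp)]
    ring
  simp only [h2, Finset.sum_add_distrib, h1]
  ring

theorem sum_sum_eq_diag_add_Iio {m : ℕ} (f : Fin m → Fin m → ℂ) (hf : ∀ i j, f i j = f j i) :
    ∑ i, ∑ j, f i j = ∑ i, f i i + 2 * ∑ i, ∑ j ∈ Finset.Iio i, f i j := by
  rw [sum_sum_eq_diag_add_Ioi f hf,
    Finset.sum_comm' (t' := Finset.univ) (s' := fun j => Finset.Iio j) (by simp)]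
  congr 2
  exact Finset.sum_congr rfl fun i _ => Finset.sum_congr rfl fun j _ => hf j i

/-- The complete symmetric type sum `∑ z^(a+1) z'^(n-1-a)`, the divided difference of
`-z^(n-1)` with respect to the inverse coordinates. -/
def divDiff {K : Type*} [CommSemiring K] (n : ℕ) (z z' : K) : K :=
  ∑ a ∈ Finset.range (n - 1), z ^ (a + 1) * z' ^ (n - 1 - a)

theorem divDiff_comm {K : Type*} [CommSemiring K] (n : ℕ) (z z' : K) :
    divDiff n z z' = divDiff n z' z := by
  unfold divDiff
  rw [← Finset.sum_range_reflect]
  refine Finset.sum_congr rfl fun a ha => ?_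
  rw [Finset.mem_range] at ha
  rw [mul_comm]
  congr 2 <;> omega

theorem divDiff_self {K : Type*} [CommRing K] {n : ℕ} (hn : 1 ≤ n) (z : K) :
    divDiff n z z = ((n : K) - 1) * z ^ n := by
  have h : ∀ a ∈ Finset.range (n - 1), z ^ (a + 1) * z ^ (n - 1 - a) = z ^ n := by
    intro a ha
    rw [Finset.mem_range] at ha
    rw [← pow_add]
    congr 1
    omega
  rw [divDiff, Finset.sum_congr rfl h, Finset.sum_const, Finset.card_range, nsmul_eq_mul,
    Nat.cast_sub hn, Nat.cast_one]

theorem sum_powerSum_mul_powerSum {ι κ : Type*} [Fintype ι] [Fintype κ] (c z : ι → ℂ)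
    (d w : κ → ℂ) (n : ℕ) :
    ∑ a ∈ Finset.range (n - 1), (∑ i, c i * z i ^ (a + 1)) * ∑ j, d j * w j ^ (n - 1 - a) =
      ∑ i, ∑ j, c i * d j * divDiff n (z i) (w j) := by
  simp only [Fintype.sum_mul_sum]
  simp only [divDiff, Finset.mul_sum]
  rw [Finset.sum_comm]
  refine Finset.sum_congr rfl fun i _ => ?_
  rw [Finset.sum_comm]
  exact Finset.sum_congr rfl fun j _ => Finset.sum_congr rfl fun a _ => by ring

/-- The zeroth order part of the action of `L₋ₙ` on the Coulomb gas integrand. -/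
theorem coulomb_weight_identity {N l n : ℕ} (hn : 1 ≤ n) (γ : ℂ) (hγ : γ ≠ 0)
    (α : Fin (N + 1) → ℂ) (z : Fin N → ℂ) (w : Fin l → ℂ) :
    (∑ k, (-(α 0 * α k.succ) / 2) * (-z k ^ n) +
      ∑ k, ∑ k' ∈ Finset.Ioi k, (-(α k.succ * α k'.succ) / 2) * divDiff n (z k') (z k)) +
      ∑ s, ((-(γ * α 0) / 2) * (-w s ^ n) +
        ∑ k, (-(γ * α k.succ) / 2) * divDiff n (w s) (z k)) +
      ∑ s, ∑ s' ∈ Finset.Iio s, (-(γ ^ 2) / 2) * divDiff n (w s) (w s') +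
      ∑ s, divDiff n (w s) (w s) +
      ∑ k, (α k.succ / 2 * ((γ / 2 + 2 / γ) - α k.succ / 2)) * ((n : ℂ) - 1) * z k ^ n =
    (α 0 + ((n : ℂ) - 1) * (γ / 2 + 2 / γ)) / 2 *
        (∑ k, α k.succ * z k ^ n + ∑ s, γ * w s ^ n) -
      1 / 4 * ∑ a ∈ Finset.range (n - 1),
        (∑ k, α k.succ * z k ^ (a + 1) + ∑ s, γ * w s ^ (a + 1)) *
        (∑ k, α k.succ * z k ^ (n - 1 - a) + ∑ s, γ * w s ^ (n - 1 - a)) := by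
  have hsplit : ∀ x y u v : ℕ → ℂ, ∑ a ∈ Finset.range (n - 1), (x a + y a) * (u a + v a) =
      ∑ a ∈ Finset.range (n - 1), x a * u a + ∑ a ∈ Finset.range (n - 1), x a * v a +
        (∑ a ∈ Finset.range (n - 1), y a * u a + ∑ a ∈ Finset.range (n - 1), y a * v a) := by
    intro x y u v
    simp only [← Finset.sum_add_distrib]
    exact Finset.sum_congr rfl fun a _ => by ring
  have h1 : ∑ k, ∑ s, α (Fin.succ k) * γ * divDiff n (z k) (w s) =
      ∑ s, ∑ k, γ * α (Fin.succ k) * divDiff n (w s) (z k) := by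
    rw [Finset.sum_comm]
    refine Finset.sum_congr rfl fun s _ => Finset.sum_congr rfl fun k _ => ?_
    rw [divDiff_comm]; ring
  rw [hsplit, sum_powerSum_mul_powerSum (fun k => α (Fin.succ k)) z (fun k => α (Fin.succ k)) z,
    sum_powerSum_mul_powerSum (fun k => α (Fin.succ k)) z (fun _ => γ) w,
    sum_powerSum_mul_powerSum (fun _ => γ) w (fun k => α (Fin.succ k)) z,
    sum_powerSum_mul_powerSum (fun _ => γ) w (fun _ => γ) w, h1,
    sum_sum_eq_diag_add_Ioi (fun i j => α (Fin.succ i) * α (Fin.succ j) * divDiff n (z i) (z j))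
      fun i j => by rw [divDiff_comm]; ring,
    sum_sum_eq_diag_add_Iio (fun i j => γ * γ * divDiff n (w i) (w j))
      fun i j => by rw [divDiff_comm]]
  simp only [divDiff_self hn]
  have e1 : ∑ k, ∑ k' ∈ Finset.Ioi k,
      (-(α k.succ * α k'.succ) / 2) * divDiff n (z k') (z k) =
      -1 / 2 * ∑ k, ∑ k' ∈ Finset.Ioi k, α k.succ * α k'.succ * divDiff n (z k) (z k') := by
    simp only [Finset.mul_sum]
    refine Finset.sum_congr rfl fun s _ => Finset.sum_congr rfl fun k _ => ?_
    rw [divDiff_comm]; ring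
  have e2 : ∑ s, ∑ k, (-(γ * α k.succ) / 2) * divDiff n (w s) (z k) =
      -1 / 2 * ∑ s, ∑ k, γ * α (Fin.succ k) * divDiff n (w s) (z k) := by
    simp only [Finset.mul_sum]
    exact Finset.sum_congr rfl fun s _ => Finset.sum_congr rfl fun k _ => by ring
  have e3 : ∑ s, ∑ s' ∈ Finset.Iio s, (-(γ ^ 2) / 2) * divDiff n (w s) (w s') =
      -1 / 2 * ∑ s, ∑ s' ∈ Finset.Iio s, γ * γ * divDiff n (w s) (w s') := by
    simp only [Finset.mul_sum]
    exact Finset.sum_congr rfl fun s _ => Finset.sum_congr rfl fun k _ => by ring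
  have e4 : ∑ k, (-(α 0 * α k.succ) / 2) * (-z k ^ n) = α 0 / 2 * ∑ k, α k.succ * z k ^ n := by
    rw [Finset.mul_sum]; exact Finset.sum_congr rfl fun k _ => by ring
  have e5 : ∑ s, (-(γ * α 0) / 2) * (-w s ^ n) = α 0 / 2 * ∑ s, γ * w s ^ n := by
    rw [Finset.mul_sum]; exact Finset.sum_congr rfl fun k _ => by ring
  have e6 : ∑ k, (α k.succ / 2 * ((γ / 2 + 2 / γ) - α k.succ / 2)) * ((n : ℂ) - 1) * z k ^ n =
      ((n : ℂ) - 1) * (γ / 2 + 2 / γ) / 2 * ∑ k, α k.succ * z k ^ n -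
      1 / 4 * ∑ k, α k.succ * α k.succ * (((n : ℂ) - 1) * z k ^ n) := by
    simp only [Finset.mul_sum, ← Finset.sum_sub_distrib]
    exact Finset.sum_congr rfl fun k _ => by ring
  have e7 : ∑ s, ((n : ℂ) - 1) * w s ^ n =
      ((n : ℂ) - 1) * (γ / 2 + 2 / γ) / 2 * ∑ s, γ * w s ^ n -
      1 / 4 * ∑ s, γ * γ * (((n : ℂ) - 1) * w s ^ n) := by
    simp only [Finset.mul_sum, ← Finset.sum_sub_distrib]
    exact Finset.sum_congr rfl fun k _ => by field_simp; ring
  rw [Finset.sum_add_distrib, e1, e2, e3, e4, e5, e6, e7]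
  ring

theorem ofReal_divDiff (n : ℕ) (z z' : ℝ) :
    ((divDiff n z z' : ℝ) : ℂ) = divDiff n (z : ℂ) (z' : ℂ) := by
  simp [divDiff]

theorem hasDerivAt_aeval_mkDerivation {σ : Type*} {f : ℝ → σ → ℂ} {g : σ → MvPolynomial σ ℂ}
    {e : ℝ} (hf : ∀ n, HasDerivAt (fun e => f e n) (MvPolynomial.aeval (f e) (g n)) e)
    (P : MvPolynomial σ ℂ) :
    HasDerivAt (fun e => MvPolynomial.aeval (f e) P)
      (MvPolynomial.aeval (f e) (MvPolynomial.mkDerivation ℂ g P)) e := by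
  induction P using MvPolynomial.induction_on with
  | C c =>
    simp only [← MvPolynomial.algebraMap_eq, AlgHom.commutes, Derivation.map_algebraMap, map_zero]
    exact hasDerivAt_const _ _
  | add P Q hP hQ => simpa only [map_add] using hP.fun_add hQ
  | mul_X P n hP =>
    simp only [map_mul, MvPolynomial.aeval_X, Derivation.leibniz, map_add, smul_eq_mul,
      MvPolynomial.mkDerivation_X]
    exact (hP.fun_mul (hf n)).congr_deriv (by ring)

theorem hasDerivAt_zero_of_affine {f : ℝ → ℝ} {f' : ℝ} (h : ∀ ε, f ε = f 0 + ε * f') :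
    HasDerivAt f f' 0 := by
  rw [funext h]
  exact ((hasDerivAt_mul_const f').const_add (f 0))

theorem hasDerivAt_ofReal_log {f : ℝ → ℝ} {f' e : ℝ} (hf : HasDerivAt f f' e) (h : f e ≠ 0) :
    HasDerivAt (fun e => (Real.log (f e) : ℂ)) ((f' / f e : ℝ) : ℂ) e :=
  (hf.log h).ofReal_comp

theorem hasDerivAt_ofReal_inv_pow {f : ℝ → ℝ} {e : ℝ} {n : ℕ} (hn : 1 ≤ n)
    (hf : HasDerivAt f (-((f e)⁻¹) ^ (n - 1)) e) (h : f e ≠ 0) (a : ℕ) :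
    HasDerivAt (fun e => (((f e : ℝ) : ℂ)⁻¹) ^ a)
      ((a : ℂ) * (((f e : ℝ) : ℂ)⁻¹) ^ (a + n)) e := by
  have h1 := ((hf.inv h).pow a).ofReal_comp
  obtain ⟨m, rfl⟩ := Nat.exists_eq_add_of_le' hn
  convert h1 using 1
  · ext; simp
  · rcases a with _ | a
    · simp
    · push_cast
      simp only [Pi.inv_apply, Complex.ofReal_inv]
      field_simp
      ring

namespace Transport

variable {N l : ℕ} {p₀ : ℝ × (Fin N → ℝ)} (V : Transport p₀.1)

/-- The direction `d` is realised at `p₀` by `κ` times the transport `V`, and both represent the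
vector field of `L₋ₙ`. -/
structure Realizes (n : ℕ) (d : ℝ × (Fin N → ℝ)) (κ : ℝ) : Prop where
  snd_eq : ∀ k, d.2 k = κ * V.v (p₀.2 k)
  v_eq : ∀ q, p₀.1 < q → κ * V.v q - d.1 = -((q - p₀.1)⁻¹) ^ (n - 1)
  S_eq : ∀ q q', p₀.1 < q → p₀.1 < q' → κ * V.S q q' = divDiff n (q - p₀.1)⁻¹ (q' - p₀.1)⁻¹

variable {V} {L R : Fin N} {n : ℕ} {d : ℝ × (Fin N → ℝ)} {κ : ℝ}

theorem Realizes.amp_line (h : V.Realizes n d κ) (hL : p₀.1 < p₀.2 L) (hLR : p₀.2 L < p₀.2 R)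
    (ε : ℝ) : V.amp L R (p₀ + ε • d) = ε * κ := by
  have h1 : V.v (p₀.2 R) - V.v (p₀.2 L) ≠ 0 := (sub_pos.2 (V.v_lt hL hLR)).ne'
  rw [amp, div_eq_iff h1]
  simp only [Prod.snd_add, Prod.smul_snd, Pi.add_apply, Pi.smul_apply, smul_eq_mul, h.snd_eq]
  ring

theorem Realizes.map_line (h : V.Realizes n d κ) (hL : p₀.1 < p₀.2 L) (hLR : p₀.2 L < p₀.2 R)
    (ε y : ℝ) : V.map L R (p₀ + ε • d) y = y + ε * (κ * V.v y) := by
  rw [map, shift, h.amp_line hL hLR]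
  simp only [Prod.snd_add, Prod.smul_snd, Pi.add_apply, Pi.smul_apply, smul_eq_mul, h.snd_eq]
  ring

theorem Realizes.hasDerivAt_map_sub_fst (h : V.Realizes n d κ) (hL : p₀.1 < p₀.2 L)
    (hLR : p₀.2 L < p₀.2 R) {y : ℝ} (hy : p₀.1 < y) :
    HasDerivAt (fun ε : ℝ => V.map L R (p₀ + ε • d) y - (p₀ + ε • d).1)
      (-((y - p₀.1)⁻¹) ^ (n - 1)) 0 := by
  simp only [h.map_line hL hLR, ← h.v_eq y hy, Prod.fst_add, Prod.smul_fst, smul_eq_mul]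
  exact hasDerivAt_zero_of_affine fun ε => by ring

theorem hasDerivAt_Tfull_line (i : Fin (N + 1)) :
    HasDerivAt (fun ε : ℝ => Tfull (p₀ + ε • d) i) (Tfull d i) 0 := by
  refine hasDerivAt_zero_of_affine fun ε => ?_
  refine Fin.cases ?_ (fun k => ?_) i <;> simp [Tfull]

theorem Realizes.hasDerivAt_one_add (h : V.Realizes n d κ) (hL : p₀.1 < p₀.2 L)
    (hLR : p₀.2 L < p₀.2 R) {y y' : ℝ} (hy : p₀.1 < y) (hy' : p₀.1 < y') :
    HasDerivAt (fun ε : ℝ => 1 + V.amp L R (p₀ + ε • d) * V.S y y')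
      (divDiff n (y - p₀.1)⁻¹ (y' - p₀.1)⁻¹) 0 := by
  simp only [h.amp_line hL hLR, ← h.S_eq y y' hy hy']
  exact hasDerivAt_zero_of_affine fun ε => by ring

theorem Realizes.hasDerivAt_ratio (hn : 1 ≤ n) (h : V.Realizes n d κ) (hL : p₀.1 < p₀.2 L)
    (hLR : p₀.2 L < p₀.2 R) (hp₀ : ∀ k, p₀.1 < p₀.2 k) {y : ℝ} (hy : p₀.1 < y)
    (hne : ∀ k, k ≠ L → k ≠ R → y ≠ p₀.2 k) (i : Fin (N + 1)) :
    HasDerivAt (fun ε : ℝ => V.ratio L R (p₀ + ε • d) y i)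
      (Fin.cases (-((y - p₀.1)⁻¹) ^ n) (fun k => divDiff n (y - p₀.1)⁻¹ (p₀.2 k - p₀.1)⁻¹) i)
      0 := by
  refine Fin.cases ?_ (fun k => ?_) i
  · simp only [ratio, Fin.cases_zero]
    refine ((h.hasDerivAt_map_sub_fst hL hLR hy).div_const (y - p₀.1)).congr_deriv ?_
    obtain ⟨m, rfl⟩ := Nat.exists_eq_add_of_le' hn
    simp only [Nat.add_sub_cancel]
    ring
  · simp only [ratio, Fin.cases_succ]
    split_ifs with hk
    · exact h.hasDerivAt_one_add hL hLR hy (hp₀ k)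
    · rw [not_or] at hk
      have hyk := hne k hk.1 hk.2
      have h1 := V.sub_eq y (p₀.2 k) hy (hp₀ k)
      rw [← h.S_eq y _ hy (hp₀ k)]
      refine hasDerivAt_zero_of_affine fun ε => ?_
      rw [div_add' _ _ _ (sub_ne_zero.2 hyk), h.map_line hL hLR, h.map_line hL hLR]
      congr 1
      simp only [Prod.snd_add, Prod.smul_snd, Pi.add_apply, Pi.smul_apply, smul_eq_mul, h.snd_eq]
      linear_combination ε * κ * h1

theorem Realizes.hasDerivAt_logFactor (hn : 1 ≤ n) (h : V.Realizes n d κ) (γ : ℂ)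
    (α : Fin (N + 1) → ℂ) (hp₀ : p₀ ∈ OrdDomain N) (hLR : L < R)
    (hadj : ∀ k, k ≠ L → k ≠ R → k < L) {x : Fin l → ℝ} (hx : ∀ s, p₀.2 L ≤ x s)
    {z : Fin N → ℂ} {w : Fin l → ℂ} (hz : ∀ k, z k = ((p₀.2 k - p₀.1 : ℝ) : ℂ)⁻¹)
    (hw : ∀ s, w s = ((x s - p₀.1 : ℝ) : ℂ)⁻¹) :
    HasDerivAt (fun ε : ℝ => V.logFactor L R γ α (p₀ + ε • d) x)
      ((∑ k, (-(α 0 * α k.succ) / 2) * (-z k ^ n) +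
        ∑ k, ∑ k' ∈ Finset.Ioi k, (-(α k.succ * α k'.succ) / 2) * divDiff n (z k') (z k)) +
        ∑ s, ((-(γ * α 0) / 2) * (-w s ^ n) +
          ∑ k, (-(γ * α k.succ) / 2) * divDiff n (w s) (z k)) +
        ∑ s, ∑ s' ∈ Finset.Iio s, (-(γ ^ 2) / 2) * divDiff n (w s) (w s') +
        ∑ s, divDiff n (w s) (w s)) 0 := by
  have hL := hp₀.1 L
  have hLR' := hp₀.2 hLR
  have hxt : ∀ s, p₀.1 < x s := fun s => hL.trans_le (hx s)
  have hne := fun s k hk hk' => ne_of_adjacent hp₀ hadj (hx s) k hk hk'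
  have hline : p₀ + (0 : ℝ) • d = p₀ := by simp
  have hwS : ∀ s s', divDiff n (w s) (w s') =
      ((divDiff n (x s - p₀.1)⁻¹ (x s' - p₀.1)⁻¹ : ℝ) : ℂ) := by
    intro s s'
    rw [ofReal_divDiff, hw, hw, Complex.ofReal_inv, Complex.ofReal_inv]
  have hone : ∀ s s', HasDerivAt
      (fun ε : ℝ => (Real.log (1 + V.amp L R (p₀ + ε • d) * V.S (x s) (x s')) : ℂ))
      (divDiff n (w s) (w s')) 0 := by
    intro s s'
    have h1 := hasDerivAt_ofReal_log (h.hasDerivAt_one_add hL hLR' (hxt s) (hxt s'))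
      (by simp [amp_self])
    exact h1.congr_deriv (by rw [hwS, hline, amp_self, zero_mul, add_zero, div_one])
  refine ((HasDerivAt.fun_add ?_ ?_).fun_add ?_).fun_add ?_
  · have h1 : HasDerivAt (fun ε : ℝ => ∑ i : Fin (N + 1), ∑ j ∈ Finset.Ioi i,
        (-(α i * α j) / 2) *
          (Real.log (Tfull (p₀ + ε • d) j - Tfull (p₀ + ε • d) i) : ℂ))
        (∑ i : Fin (N + 1), ∑ j ∈ Finset.Ioi i, (-(α i * α j) / 2) *
          (((Tfull d j - Tfull d i) / (Tfull p₀ j - Tfull p₀ i) : ℝ) : ℂ)) 0 := by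
      refine HasDerivAt.fun_sum fun i _ => HasDerivAt.fun_sum fun j hj =>
        HasDerivAt.const_mul _ ?_
      have h2 := hasDerivAt_ofReal_log
        ((hasDerivAt_Tfull_line (p₀ := p₀) (d := d) j).fun_sub
          (hasDerivAt_Tfull_line (p₀ := p₀) (d := d) i))
        (by
          simp only [hline]
          exact (sub_pos.2 (Tfull_strictMono hp₀ (Finset.mem_Ioi.1 hj))).ne')
      simpa only [hline] using h2
    refine h1.congr_deriv ?_
    rw [Fin.sum_univ_succ, Fin.sum_Ioi_zero]
    simp only [Fin.sum_Ioi_succ, Tfull, Fin.cons_succ, Fin.cons_zero, h.snd_eq]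
    congr 1
    · refine Finset.sum_congr rfl fun k _ => ?_
      have hk : p₀.2 k - p₀.1 ≠ 0 := (sub_pos.2 (hp₀.1 k)).ne'
      obtain ⟨m, rfl⟩ := Nat.exists_eq_add_of_le' hn
      rw [h.v_eq _ (hp₀.1 k), hz, Nat.add_sub_cancel]
      push_cast
      ring
    · refine Finset.sum_congr rfl fun k _ => Finset.sum_congr rfl fun k' hk' => ?_
      have hne' : p₀.2 k' - p₀.2 k ≠ 0 := (sub_pos.2 (hp₀.2 (Finset.mem_Ioi.1 hk'))).ne'
      rw [← mul_sub, V.sub_eq _ _ (hp₀.1 k') (hp₀.1 k), mul_left_comm,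
        mul_div_cancel_left₀ _ hne', h.S_eq _ _ (hp₀.1 k') (hp₀.1 k), ofReal_divDiff, hz, hz]
      push_cast
      rfl
  · refine HasDerivAt.fun_sum fun s _ => ?_
    have h1 : HasDerivAt (fun ε : ℝ => ∑ i : Fin (N + 1), (-(γ * α i) / 2) *
        (Real.log (V.ratio L R (p₀ + ε • d) (x s) i) : ℂ)) (∑ i : Fin (N + 1), (-(γ * α i) / 2) *
          ((Fin.cases (-((x s - p₀.1)⁻¹) ^ n)
            (fun k => divDiff n (x s - p₀.1)⁻¹ (p₀.2 k - p₀.1)⁻¹) i : ℝ) : ℂ)) 0 := by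
      refine HasDerivAt.fun_sum fun i _ => HasDerivAt.const_mul _ ?_
      have h2 := hasDerivAt_ofReal_log
        (h.hasDerivAt_ratio hn hL hLR' hp₀.1 (hxt s) (hne s) i)
        (by simp [V.ratio_self L R i (hxt s) (hne s)])
      rwa [hline, V.ratio_self L R i (hxt s) (hne s), div_one] at h2
    rw [Fin.sum_univ_succ] at h1
    refine h1.congr_deriv ?_
    simp only [Fin.cases_zero, Fin.cases_succ, ofReal_divDiff, hz, hw]
    push_cast
    rfl
  · exact HasDerivAt.fun_sum fun s _ => HasDerivAt.fun_sum fun s' _ => (hone s s').const_mul _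
  · exact HasDerivAt.fun_sum fun s _ => hone s s

end Transport

namespace Transport

variable {N l : ℕ} {p₀ : ℝ × (Fin N → ℝ)} {V : Transport p₀.1} {L R : Fin N} {n : ℕ}
  {d : ℝ × (Fin N → ℝ)} {κ : ℝ}

theorem Realizes.hasDerivAt_powerSums (hn : 1 ≤ n) (h : V.Realizes n d κ) (γ : ℂ)
    (α : Fin (N + 1) → ℂ) (hp₀ : p₀ ∈ OrdDomain N) (hLR : L < R) {x : Fin l → ℝ}
    (hx : ∀ s, p₀.2 L ≤ x s) (a : ℕ) :
    HasDerivAt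
      (fun ε : ℝ => powerSums γ α (p₀ + ε • d) (fun s => V.map L R (p₀ + ε • d) (x s)) a)
      (a * powerSums γ α p₀ x (a + n)) 0 := by
  have hL := hp₀.1 L
  have hxt : ∀ s, p₀.1 < x s := fun s => hL.trans_le (hx s)
  have hline : p₀ + (0 : ℝ) • d = p₀ := by simp
  have h1 : ∀ k, HasDerivAt
      (fun ε : ℝ => α k.succ * ((((p₀ + ε • d).2 k - (p₀ + ε • d).1 : ℝ) : ℂ)⁻¹) ^ a)
      (α k.succ * ((a : ℂ) * (((p₀.2 k - p₀.1 : ℝ) : ℂ)⁻¹) ^ (a + n))) 0 := by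
    intro k
    have h2 : HasDerivAt (fun ε : ℝ => (p₀ + ε • d).2 k - (p₀ + ε • d).1)
        (-((p₀.2 k - p₀.1)⁻¹) ^ (n - 1)) 0 := by
      rw [← h.v_eq _ (hp₀.1 k), ← h.snd_eq]
      refine hasDerivAt_zero_of_affine fun ε => ?_
      simp only [Prod.snd_add, Prod.smul_snd, Pi.add_apply, Pi.smul_apply, smul_eq_mul,
        Prod.fst_add, Prod.smul_fst]
      ring
    have h3 := hasDerivAt_ofReal_inv_pow hn (f := fun ε : ℝ => (p₀ + ε • d).2 k - (p₀ + ε • d).1)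
      (e := 0) (by simpa only [hline] using h2)
      (by simpa only [hline] using (sub_pos.2 (hp₀.1 k)).ne') a
    simp only [hline] at h3
    exact h3.const_mul _
  have h1' : ∀ s, HasDerivAt
      (fun ε : ℝ => γ * (((V.map L R (p₀ + ε • d) (x s) - (p₀ + ε • d).1 : ℝ) : ℂ)⁻¹) ^ a)
      (γ * ((a : ℂ) * (((x s - p₀.1 : ℝ) : ℂ)⁻¹) ^ (a + n))) 0 := by
    intro s
    have h3 := hasDerivAt_ofReal_inv_pow hn
      (f := fun ε : ℝ => V.map L R (p₀ + ε • d) (x s) - (p₀ + ε • d).1) (e := 0)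
      (by simpa only [hline, map_self] using h.hasDerivAt_map_sub_fst hL (hp₀.2 hLR) (hxt s))
      (by simpa only [hline, map_self] using (sub_pos.2 (hxt s)).ne') a
    simp only [hline, map_self] at h3
    exact h3.const_mul _
  refine ((HasDerivAt.fun_sum fun k _ => h1 k).fun_add
    (HasDerivAt.fun_sum fun s _ => h1' s)).congr_deriv ?_
  rw [powerSums, mul_add, Finset.mul_sum, Finset.mul_sum]
  congr 1 <;> exact Finset.sum_congr rfl fun _ _ => by ring

theorem Realizes.hasDerivAt_kernel (hn : 1 ≤ n) (h : V.Realizes n d κ) {γ : ℂ} (hγ : γ ≠ 0)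
    (α : Fin (N + 1) → ℂ) (P : MvPolynomial ℕ ℂ) (hp₀ : p₀ ∈ OrdDomain N) (hLR : L < R)
    (hadj : ∀ k, k ≠ L → k ≠ R → k < L) {x : Fin l → ℝ} (hx : ∀ s, p₀.2 L ≤ x s) :
    HasDerivAt (fun ε : ℝ => V.kernel L R γ α P (p₀ + ε • d, x))
      (V.kernel L R γ α (fockOp (α 0) (γ / 2 + 2 / γ) n P) (p₀, x) -
        (∑ k : Fin N, (α k.succ / 2 * ((γ / 2 + 2 / γ) - α k.succ / 2)) * ((n : ℂ) - 1) *
          (((p₀.2 k - p₀.1 : ℝ) : ℂ)⁻¹) ^ n) * V.kernel L R γ α P (p₀, x)) 0 := by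
  have hline : p₀ + (0 : ℝ) • d = p₀ := by simp
  have h1 := (h.hasDerivAt_logFactor hn γ α hp₀ hLR hadj hx (fun _ => rfl) (fun _ => rfl)).cexp
  have h2 := hasDerivAt_aeval_mkDerivation (e := 0)
    (f := fun ε : ℝ => powerSums γ α (p₀ + ε • d) (fun s => V.map L R (p₀ + ε • d) (x s)))
    (g := fun a => (a : MvPolynomial ℕ ℂ) * MvPolynomial.X (a + n)) (fun a => by
      simpa only [map_mul, map_natCast, MvPolynomial.aeval_X, hline, map_self] using
        h.hasDerivAt_powerSums hn γ α hp₀ hLR hx a) P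
  have h3 := coulomb_weight_identity hn γ hγ α (fun k => ((p₀.2 k - p₀.1 : ℝ) : ℂ)⁻¹)
    (fun s => ((x s - p₀.1 : ℝ) : ℂ)⁻¹)
  refine (h1.fun_mul h2).congr_deriv ?_
  simp only [hline, map_self, kernel, fockOp, map_add, map_sub, map_mul, map_sum,
    MvPolynomial.aeval_X, MvPolynomial.aeval_C, Algebra.algebraMap_self, RingHom.id_apply]
  simp only [powerSums]
  linear_combination Complex.exp (V.logFactor L R γ α p₀ x) *
    MvPolynomial.aeval (powerSums γ α p₀ x) P * h3

end Transport

theorem divDiff_mul_sub {K : Type*} [Field K] (m : ℕ) {u u' : K} (hu : u ≠ 0) (hu' : u' ≠ 0) :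
    (u - u') * divDiff (m + 1) u⁻¹ u'⁻¹ = u'⁻¹ ^ m - u⁻¹ ^ m := by
  have h1 : divDiff (m + 1) u⁻¹ u'⁻¹ =
      u⁻¹ * u'⁻¹ * ∑ a ∈ Finset.range m, u⁻¹ ^ a * u'⁻¹ ^ (m - 1 - a) := by
    rw [divDiff, Nat.add_sub_cancel, Finset.mul_sum]
    refine Finset.sum_congr rfl fun a ha => ?_
    rw [Finset.mem_range] at ha
    rw [show m - a = m - 1 - a + 1 by omega]
    ring
  have h2 := (Commute.all u⁻¹ u'⁻¹).mul_geom_sum₂ m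
  have h3 : (u - u') * (u⁻¹ * u'⁻¹) = -(u⁻¹ - u'⁻¹) := by
    field_simp
    ring
  rw [h1, ← mul_assoc, h3, neg_mul, h2]
  ring

/-- The transport along the vector field `-(y - t)⁻ᵐ`. -/
noncomputable def powTransport (t : ℝ) {m : ℕ} (hm : 1 ≤ m) : Transport t where
  v y := -((y - t)⁻¹) ^ m
  S y y' := divDiff (m + 1) (y - t)⁻¹ (y' - t)⁻¹
  sub_eq y y' hy hy' := by
    have := divDiff_mul_sub m (sub_pos.2 hy).ne' (sub_pos.2 hy').ne'
    rw [sub_sub_sub_cancel_right] at this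
    rw [this]
    ring
  hasDerivAt_v y hy := by
    have h := ((((hasDerivAt_id y).sub_const t).fun_inv (sub_pos.2 hy).ne').fun_pow m).fun_neg
    refine h.congr_deriv ?_
    rw [divDiff_self (by omega)]
    obtain ⟨m, rfl⟩ := Nat.exists_eq_add_of_le' hm
    simp only [id_eq, Nat.add_sub_cancel, neg_div, one_div, ← inv_pow]
    push_cast
    ring
  S_pos y y' hy hy' := by
    have h1 := inv_pos.2 (sub_pos.2 hy)
    have h2 := inv_pos.2 (sub_pos.2 hy')
    exact Finset.sum_pos (fun a _ => by positivity) ⟨0, by simp; omega⟩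
  contDiffAt_v y hy :=
    ((contDiffAt_id.sub contDiffAt_const).fun_inv (sub_pos.2 hy).ne').pow m |>.neg
  contDiffAt_S y y' hy hy' := by
    have h1 : ContDiffAt ℝ 1 (fun q : ℝ × ℝ => (q.1 - t)⁻¹) (y, y') :=
      (contDiffAt_fst.sub contDiffAt_const).fun_inv (sub_pos.2 hy).ne'
    have h2 : ContDiffAt ℝ 1 (fun q : ℝ × ℝ => (q.2 - t)⁻¹) (y, y') :=
      (contDiffAt_snd.sub contDiffAt_const).fun_inv (sub_pos.2 hy').ne'
    exact ContDiffAt.sum fun a _ => (h1.pow _).mul (h2.pow _)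

/-- On the ordered domain `L₋ₙ` is a directional derivative, along a direction realised by a
transport, plus a multiplication operator. -/
theorem exists_realizes_Lop {N n : ℕ} (hn : 1 ≤ n) (Δ : Fin N → ℂ) (p₀ : ℝ × (Fin N → ℝ)) :
    ∃ (V : Transport p₀.1) (d : ℝ × (Fin N → ℝ)) (κ : ℝ), V.Realizes n d κ ∧ ∀ F,
      Lop N Δ n F p₀ = fderiv ℝ F p₀ d +
        (∑ k, Δ k * ((n : ℂ) - 1) * (((p₀.2 k - p₀.1 : ℝ) : ℂ)⁻¹) ^ n) * F p₀ := by
  rcases hn.eq_or_lt with rfl | hn2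
  · refine ⟨powTransport p₀.1 le_rfl, (1, 0), 0, ⟨by simp, by simp, ?_⟩, fun F => ?_⟩
    · simp [divDiff]
    · simp [Lop]
  · have hm : 1 ≤ n - 1 := by omega
    refine ⟨powTransport p₀.1 hm, (0, fun k => -((p₀.2 k - p₀.1)⁻¹) ^ (n - 1)), 1,
      ⟨fun k => by simp [powTransport], fun q _ => by simp [powTransport], fun q q' _ _ => ?_⟩,
      fun F => ?_⟩
    · simp only [powTransport, one_mul]
      rw [Nat.sub_add_cancel hn]
    · have h1 : ((0, fun k => -((p₀.2 k - p₀.1)⁻¹) ^ (n - 1)) : ℝ × (Fin N → ℝ)) =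
          ∑ k, (-((p₀.2 k - p₀.1)⁻¹) ^ (n - 1)) • (0, Pi.single k 1) := by
        refine Prod.ext ?_ ?_
        · simp [Prod.fst_sum]
        · ext j
          simp [Prod.snd_sum, Finset.sum_apply, Pi.single_apply]
      rw [Lop, if_neg (by omega), h1, map_sum, Finset.sum_add_distrib, Finset.sum_mul]
      congr 1
      · refine Finset.sum_congr rfl fun k _ => ?_
        rw [map_smul, Complex.real_smul]
        push_cast
        rw [inv_pow]
      · refine Finset.sum_congr rfl fun k _ => ?_
        push_cast
        rw [inv_pow]

section Action

variable {N l : ℕ} {γ : ℂ} {α : Fin (N + 1) → ℂ} {p₀ : ℝ × (Fin N → ℝ)}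

/-- The exponents at the ends of the domain of integration are nonnegative reals. -/
structure NonnegExponents (hN : 2 ≤ N) (γ : ℂ) (α : Fin (N + 1) → ℂ) : Prop where
  ne_zero : γ ≠ 0
  screen : (-(γ ^ 2) / 2).im = 0 ∧ 0 ≤ (-(γ ^ 2) / 2).re
  left : (-(γ * α (Fin.succ ⟨N - 2, by omega⟩)) / 2).im = 0 ∧
    0 ≤ (-(γ * α (Fin.succ ⟨N - 2, by omega⟩)) / 2).re
  right : (-(γ * α (Fin.succ ⟨N - 1, by omega⟩)) / 2).im = 0 ∧
    0 ≤ (-(γ * α (Fin.succ ⟨N - 1, by omega⟩)) / 2).re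

theorem lt_of_ne_last_two {N : ℕ} (hN : 2 ≤ N) (k : Fin N) (h : k ≠ ⟨N - 2, by omega⟩)
    (h' : k ≠ ⟨N - 1, by omega⟩) : k < ⟨N - 2, by omega⟩ := by
  simp only [ne_eq, Fin.ext_iff, Fin.lt_def] at *
  omega

theorem penultimate_lt_last {N : ℕ} (hN : 2 ≤ N) :
    (⟨N - 2, by omega⟩ : Fin N) < ⟨N - 1, by omega⟩ := by
  simp only [Fin.mk_lt_mk]
  omega

theorem hasFDerivAt_CoulombP {hN : 2 ≤ N} (hE : NonnegExponents hN γ α)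
    (hp₀ : p₀ ∈ OrdDomain N) (V : Transport p₀.1) (P : MvPolynomial ℕ ℂ) :
    HasFDerivAt (CoulombP l N hN γ α P)
      (∫ x in Simplex l (p₀.2 ⟨N - 2, by omega⟩) (p₀.2 ⟨N - 1, by omega⟩),
        CGint l N γ α (Tfull p₀) x • fderiv ℝ
          (fun p => V.kernel ⟨N - 2, by omega⟩ ⟨N - 1, by omega⟩ γ α P (p, x)) p₀) p₀ ∧
    Integrable (fun x => CGint l N γ α (Tfull p₀) x • fderiv ℝ
        (fun p => V.kernel ⟨N - 2, by omega⟩ ⟨N - 1, by omega⟩ γ α P (p, x)) p₀)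
      (volume.restrict (Simplex l (p₀.2 ⟨N - 2, by omega⟩) (p₀.2 ⟨N - 1, by omega⟩))) ∧
    Integrable (fun x => CGint l N γ α (Tfull p₀) x *
        V.kernel ⟨N - 2, by omega⟩ ⟨N - 1, by omega⟩ γ α P (p₀, x))
      (volume.restrict (Simplex l (p₀.2 ⟨N - 2, by omega⟩) (p₀.2 ⟨N - 1, by omega⟩))) := by
  have hadj := lt_of_ne_last_two hN
  obtain ⟨B, hB⟩ := exists_bound_CGint (l := l) hp₀ hadj hE.screen hE.left hE.right
  have hC : IsCompact (Set.univ.pi fun _ : Fin l =>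
      Set.Icc (p₀.2 ⟨N - 2, by omega⟩) (p₀.2 ⟨N - 1, by omega⟩)) :=
    isCompact_univ_pi fun _ => isCompact_Icc
  obtain ⟨h1, h2, h3⟩ := hasFDerivAt_setIntegral_mul (volume : Measure (Fin l → ℝ))
    (K := V.kernel ⟨N - 2, by omega⟩ ⟨N - 1, by omega⟩ γ α P) hC
    (S := Simplex l (p₀.2 ⟨N - 2, by omega⟩) (p₀.2 ⟨N - 1, by omega⟩))
    (fun x hx s _ => ⟨(hx.2 s).1.le, (hx.2 s).2.le⟩)
    (fun x hx => V.contDiffAt_kernel γ α P hp₀ hadj fun s => (hx s trivial).1)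
    (measurable_CGint l N γ α (Tfull p₀)) (measurableSet_Simplex _ _ _) hB
  exact ⟨h1.congr_of_eventuallyEq (V.eventually_CoulombP_eq hN γ α P hp₀), h2, h3⟩

theorem CoulombP_eq_integral {hN : 2 ≤ N} (hp₀ : p₀ ∈ OrdDomain N) (V : Transport p₀.1)
    (P : MvPolynomial ℕ ℂ) :
    CoulombP l N hN γ α P p₀ =
      ∫ x in Simplex l (p₀.2 ⟨N - 2, by omega⟩) (p₀.2 ⟨N - 1, by omega⟩),
        CGint l N γ α (Tfull p₀) x *
          V.kernel ⟨N - 2, by omega⟩ ⟨N - 1, by omega⟩ γ α P (p₀, x) :=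
  (V.eventually_CoulombP_eq hN γ α P hp₀).self_of_nhds

/-- `L₋ₙ` acts on Coulomb gas integrals through the Fock space operator `fockOp`. -/
theorem Lop_CoulombP {hN : 2 ≤ N} (hE : NonnegExponents hN γ α) (hp₀ : p₀ ∈ OrdDomain N)
    {n : ℕ} (hn : 1 ≤ n) (P : MvPolynomial ℕ ℂ) :
    Lop N (fun i : Fin N => α i.succ / 2 * ((γ / 2 + 2 / γ) - α i.succ / 2)) n
        (CoulombP l N hN γ α P) p₀ =
      CoulombP l N hN γ α (fockOp (α 0) (γ / 2 + 2 / γ) n P) p₀ := by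
  have hadj := lt_of_ne_last_two hN
  have hLR := penultimate_lt_last hN
  obtain ⟨V, d, κ, hV, hF⟩ := exists_realizes_Lop hn
    (fun i : Fin N => α i.succ / 2 * ((γ / 2 + 2 / γ) - α i.succ / 2)) p₀
  obtain ⟨h1, h2, h3⟩ := hasFDerivAt_CoulombP (l := l) hE hp₀ V P
  rw [hF, h1.fderiv, CoulombP_eq_integral hp₀ V, CoulombP_eq_integral hp₀ V,
    ContinuousLinearMap.integral_apply h2, ← integral_const_mul,
    ← integral_add (h2.apply_continuousLinearMap d) (h3.const_mul _)]
  refine setIntegral_congr_fun (measurableSet_Simplex _ _ _) fun x hx => ?_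
  have hx' : ∀ s, p₀.2 ⟨N - 2, by omega⟩ ≤ x s := fun s => (hx.2 s).1.le
  have h4 : DifferentiableAt ℝ
      (fun p => V.kernel ⟨N - 2, by omega⟩ ⟨N - 1, by omega⟩ γ α P (p, x)) p₀ :=
    ((V.contDiffAt_kernel γ α P hp₀ hadj hx').differentiableAt one_ne_zero).comp
      (f := fun p => (p, x)) p₀ (differentiableAt_id.prodMk (differentiableAt_const x))
  have h5 := (h4.hasFDerivAt.hasLineDerivAt d).unique
    (hV.hasDerivAt_kernel hn hE.ne_zero α P hp₀ hLR hadj hx')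
  simp only [smul_apply, smul_eq_mul, h5]
  ring

/-- The Coulomb gas integral at a point of the ordered domain is linear in the insertion. -/
noncomputable def coulombLin (l : ℕ) {hN : 2 ≤ N} (hE : NonnegExponents hN γ α)
    (hp₀ : p₀ ∈ OrdDomain N) : MvPolynomial ℕ ℂ →ₗ[ℂ] ℂ where
  toFun P := CoulombP l N hN γ α P p₀
  map_add' P Q := by
    have V := powTransport p₀.1 le_rfl
    simp only [CoulombP_eq_integral hp₀ V]
    rw [← integral_add (hasFDerivAt_CoulombP hE hp₀ V P).2.2
      (hasFDerivAt_CoulombP hE hp₀ V Q).2.2]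
    congr 1
    ext x
    simp only [Transport.kernel, map_add]
    ring
  map_smul' c P := by
    have V := powTransport p₀.1 le_rfl
    simp only [CoulombP_eq_integral hp₀ V]
    rw [RingHom.id_apply, smul_eq_mul, ← integral_const_mul]
    congr 1
    ext x
    simp only [Transport.kernel, map_smul, smul_eq_mul]
    ring

theorem coulombLin_apply {hN : 2 ≤ N} (hE : NonnegExponents hN γ α) (hp₀ : p₀ ∈ OrdDomain N)
    (P : MvPolynomial ℕ ℂ) : coulombLin l hE hp₀ P = CoulombP l N hN γ α P p₀ := rfl

end Action

theorem Lop_congr {N : ℕ} (Δ : Fin N → ℂ) (n : ℕ) {F G : ℝ × (Fin N → ℝ) → ℂ}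
    {p : ℝ × (Fin N → ℝ)} (h : F =ᶠ[nhds p] G) : Lop N Δ n F p = Lop N Δ n G p := by
  simp only [Lop, h.fderiv_eq, h.self_of_nhds]

theorem foldr_Lop_CoulombC {N l : ℕ} {γ : ℂ} {α : Fin (N + 1) → ℂ} {hN : 2 ≤ N}
    (hE : NonnegExponents hN γ α) (w : List ℕ) (hw : ∀ n ∈ w, 1 ≤ n) (p : ℝ × (Fin N → ℝ))
    (hp : p ∈ OrdDomain N) :
    w.foldr (Lop N fun i : Fin N => α i.succ / 2 * ((γ / 2 + 2 / γ) - α i.succ / 2))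
        (CoulombC l N hN γ α) p =
      CoulombP l N hN γ α
        (w.foldr (fun n P => fockLin (α 0) (γ / 2 + 2 / γ) n P) 1) p := by
  induction w generalizing p with
  | nil => simp only [List.foldr_nil, CoulombP_one]
  | cons n w ih =>
    simp only [List.forall_mem_cons] at hw
    have h : w.foldr (Lop N fun i : Fin N => α i.succ / 2 * ((γ / 2 + 2 / γ) - α i.succ / 2))
        (CoulombC l N hN γ α) =ᶠ[nhds p] CoulombP l N hN γ α
          (w.foldr (fun n P => fockLin (α 0) (γ / 2 + 2 / γ) n P) 1) := by
      filter_upwards [eventually_mem_OrdDomain hp] with q hq using ih hw.2 q hq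
    rw [List.foldr_cons, List.foldr_cons, Lop_congr _ n h, Lop_CoulombP hE hp hw.1]
    rfl

/-- BPZ equations of order `r` for the real Coulomb gas integral: with `γ = ib`
(`b > 0`), `χ = γ/2` or `2/γ`, `α₀ = −(r−1)χ`, `α_{N−1} = ia`, `α_N = ia'`
(`a, a' > 0`, `ab/2 ≥ r`, `a'b/2 ≥ r`), one has `𝒟_r C^{(l)} = 0` on the ordered
domain `{t < t₁ < ⋯ < t_N}`. -/
theorem BPZ_CoulombGas (r l N : ℕ) (hr : 1 ≤ r) (hl : 1 ≤ l) (hN : 2 ≤ N)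
    (b a a' : ℝ) (hb : 0 < b) (ha : 0 < a) (ha' : 0 < a')
    (γ χ : ℂ) (hγ : γ = b * Complex.I) (hχ : χ = γ / 2 ∨ χ = 2 / γ)
    (α : Fin (N + 1) → ℂ)
    (hα0 : α 0 = -((r : ℂ) - 1) * χ)
    (hαN1 : α ⟨N - 1, by omega⟩ = a * Complex.I)
    (hαN : α ⟨N, by omega⟩ = a' * Complex.I)
    (hmom1 : (r : ℝ) ≤ a * b / 2) (hmom2 : (r : ℝ) ≤ a' * b / 2) :
    ∀ p ∈ OrdDomain N,
      Dr N (fun i : Fin N => α i.succ / 2 * ((γ / 2 + 2 / γ) - α i.succ / 2)) r χ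
        (CoulombC l N hN γ α) p = 0 := by
  intro p hp
  have hb0 : (b : ℂ) ≠ 0 := by exact_mod_cast hb.ne'
  have hγ0 : γ ≠ 0 := hγ ▸ mul_ne_zero hb0 Complex.I_ne_zero
  have hχ0 : χ ≠ 0 := by
    rcases hχ with rfl | rfl
    · exact div_ne_zero hγ0 two_ne_zero
    · exact div_ne_zero two_ne_zero hγ0
  have hQ : χ + 1 / χ = γ / 2 + 2 / γ := by
    rcases hχ with rfl | rfl
    · rw [one_div_div]
    · rw [one_div_div, add_comm]
  have hexp : ∀ {c : ℝ} {u : ℂ}, 0 < c → u = c * Complex.I →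
      (-(γ * u) / 2).im = 0 ∧ 0 ≤ (-(γ * u) / 2).re := by
    rintro c _ hc rfl
    have h : -(γ * (c * Complex.I)) / 2 = ((b * c / 2 : ℝ) : ℂ) := by
      rw [hγ]
      push_cast
      linear_combination (-(b : ℂ) * c / 2) * Complex.I_sq
    rw [h]
    exact ⟨Complex.ofReal_im _, by rw [Complex.ofReal_re]; positivity⟩
  have hE : NonnegExponents hN γ α := by
    refine ⟨hγ0, ?_, hexp ha (hαN1 ▸ congrArg α ?_), hexp ha' (hαN ▸ congrArg α ?_)⟩
    · rw [sq]
      exact hexp hb hγ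
    · ext
      simp only [Fin.succ_mk]
      omega
    · ext
      simp only [Fin.succ_mk]
      omega
  have hsing := sum_BSAcoeff_words_eq_zero (fockLin (α 0) (γ / 2 + 2 / γ))
    (expSum (-1 / (2 * χ))) χ r fun m => by
      rw [← sum_fockOp_expSum χ hχ0 r m, hQ, ← hα0]
      rfl
  have hlin := congrArg (coulombLin l hE hp) hsing
  rw [map_zero, map_sum] at hlin
  rw [Dr, ← hlin]
  refine Finset.sum_congr rfl fun k _ => ?_
  rw [map_sum]
  refine Finset.sum_congr rfl fun n hn => ?_
  rw [map_smul, smul_eq_mul, coulombLin_apply,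
    foldr_Lop_CoulombC hE _ (by simpa [List.forall_mem_ofFn_iff] using (mem_comps.1 hn).1) p hp,
    expSum]
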